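/- arXiv:1107.0563 — 2 statements merged into one kernel-verified Lean document; each statement's English description precedes it below -/
import Mathlib

section
/- Let I_1, I_2 be squarefree monomial ideals of S = K[x_1,…,x_n] such that X(I_1) ∩ X(I_2) = ∅, where X(I) is the set of variables appearing in the minimal monomial generators of I. If ara I_i = pd_S S/I_i holds for i = 1, 2, then ara(I_1 + I_2) = pd_S S/(I_1 + I_2). -/
open CategoryTheory MvPolynomial

universe u

/-- The projective dimension (possibly `⊤`) of a module `M` over a commutative
ring `R`, via the standard characterization by vanishing of `Ext` groups. -/
noncomputable def pdim (R : Type u) [CommRing R] (M : ModuleCat.{u} R) : ℕ∞ :=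
  sInf {n : ℕ∞ | ∀ k : ℕ, n < (k : ℕ∞) → ∀ N : ModuleCat.{u} R,
    Subsingleton (((Ext R (ModuleCat.{u} R) k).obj (Opposite.op M)).obj N)}

/-- The arithmetical rank of an ideal. -/
noncomputable def ara {R : Type*} [CommRing R] (I : Ideal R) : ℕ :=
  sInf {r : ℕ | ∃ a : Fin r → R, (Ideal.span (Set.range a)).radical = I.radical}

/-!
Statement 8: if `I₁, I₂` are squarefree monomial ideals in disjoint sets of
variables and `ara Iᵢ = pd_S S/Iᵢ` for `i = 1, 2`, then
`ara (I₁ + I₂) = pd_S S/(I₁ + I₂)`.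
-/

section PdimBridge

variable {R : Type u} [CommRing R]

/-- Vanishing of the left-derived `Ext` agrees with vanishing of the derived-category `Ext`. -/
theorem subsingleton_Ext_succ_iff (M N : ModuleCat.{u} R) (k : ℕ) :
    Subsingleton (((_root_.Ext R (ModuleCat.{u} R) (k + 1)).obj (Opposite.op M)).obj N) ↔
      Subsingleton (Abelian.Ext M N (k + 1)) := by
  let P := projectiveResolution M
  have e := P.isoExt (R := R) (k + 1) N
  rw [← ModuleCat.isZero_iff_subsingleton, e.isZero_iff,
    ← HomologicalComplex.exactAt_iff_isZero_homology]
  rw [HomologicalComplex.exactAt_iff' _ k (k + 1) (k + 2) (by simp) (by simp),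
    ShortComplex.moduleCat_exact_iff]
  constructor
  · intro h
    refine subsingleton_of_forall_eq 0 fun α => ?_
    obtain ⟨f, hf, rfl⟩ := P.extMk_surjective α (k + 2) rfl
    rw [P.extMk_eq_zero_iff _ _ _ _ k rfl]
    obtain ⟨g, hg⟩ := h f hf
    exact ⟨g, hg⟩
  · intro h f hf
    let f' : P.complex.X (k + 1) ⟶ N := f
    have hf' : P.complex.d (k + 2) (k + 1) ≫ f' = 0 := hf
    exact (P.extMk_eq_zero_iff f' (k + 2) rfl hf' k rfl).1 (Subsingleton.elim _ 0)

theorem pdim_le_of_hasProjectiveDimensionLT {M : ModuleCat.{u} R} {n : ℕ}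
    (h : HasProjectiveDimensionLT M (n + 1)) : pdim R M ≤ n := by
  refine sInf_le fun k hk N => ?_
  obtain ⟨k, rfl⟩ := Nat.exists_eq_add_of_lt (Nat.cast_lt.1 hk)
  rw [subsingleton_Ext_succ_iff]
  exact HasProjectiveDimensionLT.subsingleton M (n + 1) _ (by omega) N

theorem hasProjectiveDimensionLT_of_pdim_le {M : ModuleCat.{u} R} {n : ℕ}
    (h : pdim R M ≤ n) : HasProjectiveDimensionLT M (n + 1) := by
  have hmem := csInf_mem (s := {n : ℕ∞ | ∀ k : ℕ, n < (k : ℕ∞) → ∀ N : ModuleCat.{u} R,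
    Subsingleton (((_root_.Ext R (ModuleCat.{u} R) k).obj (Opposite.op M)).obj N)})
    ⟨⊤, fun k hk => absurd hk (by simp)⟩
  refine HasProjectiveDimensionLT.mk fun i hi Y e => ?_
  obtain ⟨k, rfl⟩ := Nat.exists_eq_add_of_le' (show 1 ≤ i by omega)
  have := (subsingleton_Ext_succ_iff M Y k).1
    (hmem (k + 1) (lt_of_le_of_lt h (Nat.cast_lt.2 (by omega))) Y)
  exact Subsingleton.elim _ _

end PdimBridge

section ExtNull

universe w v

variable {C : Type u} [Category.{v} C] [Abelian C] [HasExt.{w} C]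

/-- A morphism is `Ext`-null in degree `k` if it induces zero on `Ext^k(-, N)` for all `N`. -/
def ExtNull (k : ℕ) {M' M : C} (f : M' ⟶ M) : Prop :=
  ∀ ⦃N : C⦄ (e : Abelian.Ext M N k), (Abelian.Ext.mk₀ f).comp e (zero_add k) = 0

theorem ExtNull.comp_right {k : ℕ} {M₁ M₂ M₃ : C} {f : M₁ ⟶ M₂} (hf : ExtNull k f)
    (g : M₂ ⟶ M₃) : ExtNull k (f ≫ g) := fun N e => by
  rw [← Abelian.Ext.mk₀_comp_mk₀_assoc, hf]

theorem ExtNull.comp_left {k : ℕ} {M₁ M₂ M₃ : C} {g : M₂ ⟶ M₃} (hg : ExtNull k g)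
    (f : M₁ ⟶ M₂) : ExtNull k (f ≫ g) := fun N e => by
  rw [← Abelian.Ext.mk₀_comp_mk₀_assoc, hg, Abelian.Ext.comp_zero]

theorem extNull_of_projective (k : ℕ) {M₁ M₂ : C} [Projective M₁] (f : M₁ ⟶ M₂) :
    ExtNull (k + 1) f := fun _ _ => Abelian.Ext.eq_zero_of_projective _

theorem ExtNull.of_shortExact {k : ℕ} {S₁ S₂ S₃ : ShortComplex C} (h₁ : S₁.ShortExact)
    (h₂ : S₂.ShortExact) (φ : S₁ ⟶ S₂) (ψ : S₂ ⟶ S₃) (hφ : ExtNull k φ.τ₁)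
    (hψ : ExtNull (1 + k) ψ.τ₂) : ExtNull (1 + k) (φ.τ₃ ≫ ψ.τ₃) := fun N e => by
  obtain ⟨y, hy⟩ := Abelian.Ext.contravariant_sequence_exact₃ h₂ N
    ((Abelian.Ext.mk₀ ψ.τ₃).comp e (zero_add _)) (by
      rw [Abelian.Ext.mk₀_comp_mk₀_assoc, ← ψ.comm₂₃, ← Abelian.Ext.mk₀_comp_mk₀_assoc, hψ]) rfl
  rw [← Abelian.Ext.mk₀_comp_mk₀_assoc, ← hy,
    ← Abelian.Ext.comp_assoc (Abelian.Ext.mk₀ φ.τ₃) h₂.extClass y (zero_add 1) rfl (by omega),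
    ← ShortComplex.ShortExact.extClass_naturality h₁ h₂ φ,
    Abelian.Ext.comp_assoc _ _ y (add_zero 1) (zero_add k) (by omega), hφ,
    Abelian.Ext.comp_zero]

end ExtNull

section NullPowers

variable {S : Type u} [CommRing S]

/-- The projection `S ⧸ P ⟶ S ⧸ Q` for ideals `P ≤ Q`. -/
noncomputable def quotProj {P Q : Ideal S} (h : P ≤ Q) :
    ModuleCat.of S (S ⧸ P) ⟶ ModuleCat.of S (S ⧸ Q) :=
  ModuleCat.ofHom (Submodule.factor h)

theorem quotProj_comp {P Q R : Ideal S} (h : P ≤ Q) (h' : Q ≤ R) :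
    quotProj h ≫ quotProj h' = quotProj (h.trans h') := by
  refine ModuleCat.hom_ext (LinearMap.ext fun x => ?_)
  obtain ⟨x, rfl⟩ := Submodule.Quotient.mk_surjective _ x
  rfl

/-- The colon ideal `P : b`. -/
def colon (P : Ideal S) (b : S) : Ideal S := Submodule.comap (LinearMap.mulLeft S b) P

theorem colon_mono {P Q : Ideal S} (h : P ≤ Q) (b : S) : colon P b ≤ colon Q b := fun _ hx => h hx

/-- The sequence `S ⧸ (P : b) ⟶ S ⧸ P ⟶ S ⧸ (P ⊔ (b))`. -/
noncomputable def colonSequence (P : Ideal S) (b : S) : ShortComplex (ModuleCat.{u} S) where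
  X₁ := ModuleCat.of S (S ⧸ colon P b)
  X₂ := ModuleCat.of S (S ⧸ P)
  X₃ := ModuleCat.of S (S ⧸ (P ⊔ Ideal.span {b}))
  f := ModuleCat.ofHom (Submodule.mapQ _ _ (LinearMap.mulLeft S b) le_rfl)
  g := quotProj le_sup_left
  zero := by
    refine ModuleCat.hom_ext (LinearMap.ext fun x => ?_)
    obtain ⟨x, rfl⟩ := Submodule.Quotient.mk_surjective _ x
    refine (Submodule.Quotient.mk_eq_zero (P ⊔ Ideal.span {b})).2 ?_
    exact Ideal.mem_sup_right (Ideal.mem_span_singleton.2 ⟨x, rfl⟩)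

theorem colonSequence_shortExact (P : Ideal S) (b : S) : (colonSequence P b).ShortExact := by
  refine ModuleCat.shortComplex_shortExact _ ?_ ?_ ?_
  · intro y
    refine ⟨fun hy => ?_, ?_⟩
    · obtain ⟨y, rfl⟩ := Submodule.Quotient.mk_surjective _ y
      have hy : y ∈ P ⊔ Ideal.span {b} := (Submodule.Quotient.mk_eq_zero _).1 hy
      obtain ⟨p, hp, q, hq, rfl⟩ := Submodule.mem_sup.1 hy
      obtain ⟨c, rfl⟩ := Ideal.mem_span_singleton.1 hq
      refine ⟨Submodule.Quotient.mk c, (Submodule.Quotient.eq P).2 ?_⟩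
      have : b * c - (p + b * c) = -p := by ring
      simpa [this] using hp
    · rintro ⟨x, rfl⟩
      exact ConcreteCategory.congr_hom (colonSequence P b).zero x
  · refine (injective_iff_map_eq_zero (Submodule.mapQ (colon P b) P
      (LinearMap.mulLeft S b) le_rfl)).2 fun x hx => ?_
    obtain ⟨x, rfl⟩ := Submodule.Quotient.mk_surjective _ x
    exact (Submodule.Quotient.mk_eq_zero (colon P b)).2 ((Submodule.Quotient.mk_eq_zero P).1 hx)
  · intro y
    obtain ⟨y, rfl⟩ := Submodule.Quotient.mk_surjective _ y
    exact ⟨Submodule.Quotient.mk y, rfl⟩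

/-- Functoriality of `colonSequence` in the ideal. -/
noncomputable def colonSequenceMap {P Q : Ideal S} (h : P ≤ Q) (b : S) :
    colonSequence P b ⟶ colonSequence Q b where
  τ₁ := quotProj (colon_mono h b)
  τ₂ := quotProj h
  τ₃ := quotProj (sup_le_sup_right h _)
  comm₁₂ := by
    refine ModuleCat.hom_ext (LinearMap.ext fun x => ?_)
    obtain ⟨x, rfl⟩ := Submodule.Quotient.mk_surjective _ x
    rfl
  comm₂₃ := by
    refine ModuleCat.hom_ext (LinearMap.ext fun x => ?_)
    obtain ⟨x, rfl⟩ := Submodule.Quotient.mk_surjective _ x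
    rfl

/-- Above degree `r`, every `S ⧸ Q` with `J ^ s ≤ Q` receives an `Ext`-null
projection from some `S ⧸ J ^ s'`. -/
def NullPowers (J : Ideal S) (r : ℕ) : Prop :=
  ∀ k, r < k → ∀ (Q : Ideal S) (s : ℕ), J ^ s ≤ Q →
    ∃ (s' : ℕ) (h : J ^ s' ≤ Q), ExtNull k (quotProj h)

theorem NullPowers.mono {J : Ideal S} {r r' : ℕ} (h : NullPowers J r) (hr : r ≤ r') :
    NullPowers J r' := fun k hk => h k (hr.trans_lt hk)

theorem nullPowers_bot : NullPowers (⊥ : Ideal S) 0 := by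
  intro k hk Q s _
  obtain ⟨k, rfl⟩ := Nat.exists_eq_add_of_le' hk
  refine ⟨1, by simp, ?_⟩
  have : Module.Projective S (S ⧸ (⊥ : Ideal S) ^ 1) := by
    rw [pow_one]
    exact Module.Projective.of_equiv (Submodule.quotEquivOfEqBot ⊥ rfl).symm
  have : Projective (ModuleCat.of S (S ⧸ (⊥ : Ideal S) ^ 1)) :=
    (IsProjective.iff_projective _).1 this
  exact extNull_of_projective k _

theorem exists_colon_pow_le [IsNoetherianRing S] [IsDomain S] (J : Ideal S) {b : S} (hb : b ≠ 0)
    (u : ℕ) : ∃ m, ∀ s, m ≤ s → colon (J ^ s) b ≤ J ^ u := by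
  obtain ⟨c, hc⟩ := Ideal.exists_pow_inf_eq_pow_smul J (Ideal.span {b})
  refine ⟨c + u, fun s hs x hx => ?_⟩
  have hx' : b * x ∈ J ^ (c + u) • (⊤ : Ideal S) ⊓ Ideal.span {b} :=
    ⟨by simpa using Ideal.pow_le_pow_right hs hx, Ideal.mem_span_singleton.2 ⟨x, rfl⟩⟩
  rw [hc _ (by omega), Nat.add_sub_cancel_left] at hx'
  have hx' : b * x ∈ J ^ u * Ideal.span {b} :=
    (Ideal.mul_mono_right inf_le_right : _ ≤ J ^ u * Ideal.span {b}) hx'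
  obtain ⟨y, hy, hyx⟩ := Ideal.mem_mul_span_singleton.1 hx'
  rw [mul_comm] at hyx
  rwa [← mul_left_cancel₀ hb hyx]

theorem NullPowers.sup_span_singleton [IsNoetherianRing S] [IsDomain S] {J : Ideal S} {r : ℕ}
    (h : NullPowers J r) (a : S) : NullPowers (J ⊔ Ideal.span {a}) (r + 1) := by
  by_cases ha : a = 0
  · simpa [ha] using h.mono (Nat.le_succ r)
  intro k hk Q s hQ
  obtain ⟨k, rfl⟩ := Nat.exists_eq_add_of_le (show 1 ≤ k by omega)
  set b := a ^ s
  have hb : b ≠ 0 := pow_ne_zero _ ha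
  have hQ' : J ^ s ⊔ Ideal.span {b} ≤ Q :=
    (sup_le (Ideal.pow_right_mono le_sup_left s) (by
      rw [← Ideal.span_singleton_pow]; exact Ideal.pow_right_mono le_sup_right s)).trans hQ
  obtain ⟨s', hs', hn'⟩ := h (1 + k) (by omega) (J ^ s) s le_rfl
  have hcol : J ^ s' ≤ colon (J ^ s') b := fun x hx => Ideal.mul_mem_left _ _ hx
  obtain ⟨u, hu, hnu⟩ := h k (by omega) _ s' hcol
  obtain ⟨m, hm⟩ := exists_colon_pow_le J hb u
  have hle : J ^ (m + s') ≤ J ^ s' := Ideal.pow_le_pow_right (by omega)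
  have key : ExtNull (1 + k) (quotProj (sup_le_sup_right hle (Ideal.span {b})) ≫
      quotProj (sup_le_sup_right hs' (Ideal.span {b}))) :=
    ExtNull.of_shortExact (colonSequence_shortExact (J ^ (m + s')) b)
    (colonSequence_shortExact (J ^ s') b) (colonSequenceMap hle b) (colonSequenceMap hs' b)
    (by
      have := hnu.comp_left (quotProj (hm (m + s') (by omega)))
      rwa [quotProj_comp] at this) hn'
  have hZ : (J ⊔ Ideal.span {a}) ^ (m + s' + s) ≤ J ^ (m + s') ⊔ Ideal.span {b} := by
    rw [← Ideal.span_singleton_pow]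
    exact Ideal.sup_pow_add_le_pow_sup_pow
  have key' := (key.comp_right (quotProj hQ')).comp_left (quotProj hZ)
  refine ⟨m + s' + s, hZ.trans ((sup_le_sup_right (hle.trans hs') _).trans hQ'), ?_⟩
  rwa [quotProj_comp, quotProj_comp, quotProj_comp] at key'

theorem nullPowers_span_range [IsNoetherianRing S] [IsDomain S] {r : ℕ} (a : Fin r → S) :
    NullPowers (Ideal.span (Set.range a)) r := by
  induction r with
  | zero => simpa using nullPowers_bot
  | succ r ih =>
    have e : Ideal.span (Set.range a) =
        Ideal.span (Set.range (Fin.tail a)) ⊔ Ideal.span {a 0} := by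
      rw [← Ideal.span_union, Set.union_comm, Set.singleton_union, ← Fin.range_cons,
        Fin.cons_self_tail]
    rw [e]
    exact (ih _).sup_span_singleton _

end NullPowers

section ExtAdjunction

universe w w' v v' u'

open Limits

variable {C : Type u} [Category.{v} C] [Abelian C] [HasExt.{w} C]
variable {D : Type u'} [Category.{v'} D] [Abelian D] [HasExt.{w'} D]

theorem exists_mapExactFunctor_comp_counit [EnoughProjectives C] {F : C ⥤ D} {G : D ⥤ C}
    (adj : F ⊣ G) [F.Additive] [PreservesFiniteLimits F] [PreservesFiniteColimits F]
    [F.PreservesProjectiveObjects] (X : C) (Y : D) (n : ℕ) (g : Abelian.Ext (F.obj X) Y n) :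
    ∃ e : Abelian.Ext X (G.obj Y) n,
      (e.mapExactFunctor F).comp (Abelian.Ext.mk₀ (adj.counit.app Y)) (add_zero n) = g := by
  induction n generalizing X with
  | zero =>
    obtain ⟨f, rfl⟩ := (Abelian.Ext.mk₀_bijective _ _).2 g
    refine ⟨Abelian.Ext.mk₀ (adj.homEquiv X Y f), ?_⟩
    rw [Abelian.Ext.mapExactFunctor_mk₀, Abelian.Ext.mk₀_comp_mk₀]
    exact congrArg _ ((adj.homEquiv_counit X Y _).symm.trans (Equiv.symm_apply_apply _ f))
  | succ n ih =>
    let P : ProjectivePresentation X := Classical.arbitrary _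
    let S := ShortComplex.mk _ _ (kernel.condition P.f)
    have hP : Projective (S.map F).X₂ :=
      Functor.PreservesProjectiveObjects.projective_obj P.projective
    have hS : S.ShortExact := { exact := ShortComplex.exact_kernel P.f }
    obtain ⟨y, hy⟩ := Abelian.Ext.contravariant_sequence_exact₃ (hS.map_of_exact F) _ g
      (Abelian.Ext.eq_zero_of_projective _) (add_comm 1 n)
    obtain ⟨e, rfl⟩ := ih _ y
    refine ⟨hS.extClass.comp e (add_comm 1 n), ?_⟩
    rw [Abelian.Ext.mapExactFunctor_comp, Abelian.Ext.mapExactFunctor_extClass, ← hy]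
    exact Abelian.Ext.comp_assoc_of_third_deg_zero _ _ _ _

theorem ExtNull.map [EnoughProjectives C] {F : C ⥤ D} {G : D ⥤ C}
    (adj : F ⊣ G) [F.Additive] [PreservesFiniteLimits F] [PreservesFiniteColimits F]
    [F.PreservesProjectiveObjects] {k : ℕ} {M₁ M₂ : C} {f : M₁ ⟶ M₂} (hf : ExtNull k f) :
    ExtNull k (F.map f) := fun N g => by
  obtain ⟨e, rfl⟩ := exists_mapExactFunctor_comp_counit adj M₂ N k g
  rw [← Abelian.Ext.mapExactFunctor_mk₀, ← Abelian.Ext.comp_assoc_of_third_deg_zero,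
    ← Abelian.Ext.mapExactFunctor_comp, hf, Abelian.Ext.mapExactFunctor_zero,
    Abelian.Ext.zero_comp]

end ExtAdjunction

section RestrictScalars

variable {R R' : Type u} [CommRing R] [CommRing R']

theorem projective_trans [Algebra R R'] [Module.Projective R R'] (M : Type u) [AddCommGroup M]
    [Module R M] [Module R' M] [IsScalarTower R R' M] [Module.Projective R' M] :
    Module.Projective R M := by
  classical
  have : Module.Projective R (M →₀ R') := .of_equiv (finsuppLequivDFinsupp (M := R') R).symm
  obtain ⟨s, hs⟩ := Module.projective_def'.1 ‹Module.Projective R' M›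
  exact Module.Projective.of_split (s.restrictScalars R)
    ((Finsupp.linearCombination R' id).restrictScalars R) (LinearMap.ext fun x => LinearMap.congr_fun hs x)

theorem preservesProjective_restrictScalars (φ : R →+* R')
    (h : @Module.Projective R _ R' _ φ.toAlgebra.toModule) :
    (ModuleCat.restrictScalars.{u} φ).PreservesProjectiveObjects := by
  refine ⟨fun {P} hP => ?_⟩
  have hP' : Module.Projective R' P := (IsProjective.iff_projective P).2 hP
  let _ := φ.toAlgebra
  let _ : Module R P := Module.compHom P φ
  have : IsScalarTower R R' P := ⟨fun a b c => mul_smul (φ a) b c⟩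
  exact (IsProjective.iff_projective (R := R) (P : Type u)).1 (projective_trans (R' := R') P)

theorem projective_of_semilinear_retract (φ : R →+* R') {ι : Type*} (r : R' →+ (ι →₀ R))
    (hr : ∀ a x, r (φ a * x) = a • r x) (i : (ι →₀ R) →+ R')
    (hi : ∀ a c, i (a • c) = φ a * i c) (hir : ∀ x, i (r x) = x) :
    @Module.Projective R _ R' _ φ.toAlgebra.toModule := by
  let _ := φ.toAlgebra
  exact Module.Projective.of_split (P := R') (M := ι →₀ R) { r with map_smul' := hr }
    { i with map_smul' := hi } (LinearMap.ext hir)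

theorem extNull_restrictScalars (φ : R →+* R')
    (h : @Module.Projective R _ R' _ φ.toAlgebra.toModule)
    {k : ℕ} {M₁ M₂ : ModuleCat.{u} R'} {f : M₁ ⟶ M₂} (hf : ExtNull k f) :
    ExtNull k ((ModuleCat.restrictScalars.{u} φ).map f) := by
  have := preservesProjective_restrictScalars φ h
  exact hf.map (ModuleCat.restrictCoextendScalarsAdj φ)

end RestrictScalars

section PowerMap

variable {σ : Type*} {K : Type*} [Field K]

/-- The residue of an exponent vector modulo `m`. -/
noncomputable def expMod (m : ℕ) (α : σ →₀ ℕ) : σ →₀ ℕ := α.mapRange (· % m) (Nat.zero_mod m)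

/-- The quotient of an exponent vector by `m`. -/
noncomputable def expDiv (m : ℕ) (α : σ →₀ ℕ) : σ →₀ ℕ := α.mapRange (· / m) (Nat.zero_div m)

theorem expMod_smul_add (m : ℕ) (β α : σ →₀ ℕ) : expMod m (m • β + α) = expMod m α := by
  ext v
  simp [expMod]

theorem expDiv_smul_add {m : ℕ} (hm : 0 < m) (β α : σ →₀ ℕ) :
    expDiv m (m • β + α) = β + expDiv m α := by
  ext v
  simp [expDiv, Nat.mul_add_div hm]

theorem smul_expDiv_add_expMod (m : ℕ) (α : σ →₀ ℕ) : m • expDiv m α + expMod m α = α := by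
  ext v
  simp [expDiv, expMod, Nat.div_add_mod]

/-- Decomposition of a polynomial with respect to the residues modulo `m` of its exponents. -/
noncomputable def residueDecomp (m : ℕ) :
    MvPolynomial σ K →ₗ[K] ((σ →₀ ℕ) →₀ MvPolynomial σ K) :=
  (basisMonomials σ K).constr K fun α => Finsupp.single (expMod m α) (monomial (expDiv m α) 1)

theorem residueDecomp_monomial (m : ℕ) (α : σ →₀ ℕ) (c : K) :
    residueDecomp m (monomial α c) =
      Finsupp.single (expMod m α) (monomial (expDiv m α) c) := by
  have h : monomial α c = c • basisMonomials σ K α := by simp [smul_monomial]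
  rw [h, map_smul, residueDecomp, Module.Basis.constr_basis, Finsupp.smul_single, smul_monomial,
    smul_eq_mul, mul_one]

theorem residueDecomp_expand_mul {m : ℕ} (hm : 0 < m) (a x : MvPolynomial σ K) :
    residueDecomp m (expand m a * x) = a • residueDecomp m x := by
  induction a using MvPolynomial.induction_on' with
  | add p q hp hq => rw [map_add, add_mul, map_add, hp, hq, add_smul]
  | monomial β b =>
    induction x using MvPolynomial.induction_on' with
    | add p q hp hq => rw [mul_add, map_add, hp, hq, map_add, smul_add]
    | monomial α c =>
      rw [expand_monomial, monomial_mul, residueDecomp_monomial, residueDecomp_monomial,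
        Finsupp.smul_single, smul_eq_mul, monomial_mul, expMod_smul_add, expDiv_smul_add hm]

/-- Reassembly of a polynomial from its residue components. -/
noncomputable def residueSum (m : ℕ) :
    ((σ →₀ ℕ) →₀ MvPolynomial σ K) →+ MvPolynomial σ K :=
  Finsupp.liftAddHom fun ρ =>
    (AddMonoidHom.mulRight (monomial ρ (1 : K))).comp (expand m : _ →ₐ[K] _).toAddMonoidHom

theorem residueSum_single (m : ℕ) (ρ : σ →₀ ℕ) (a : MvPolynomial σ K) :
    residueSum m (Finsupp.single ρ a) = expand m a * monomial ρ 1 := by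
  simp [residueSum]

theorem residueSum_smul (m : ℕ) (a : MvPolynomial σ K) (c : (σ →₀ ℕ) →₀ MvPolynomial σ K) :
    residueSum m (a • c) = expand m a * residueSum m c := by
  induction c using Finsupp.induction_linear with
  | zero => simp
  | add f g hf hg => rw [smul_add, map_add, hf, hg, map_add, mul_add]
  | single ρ b => rw [Finsupp.smul_single, residueSum_single, residueSum_single, smul_eq_mul,
      map_mul, mul_assoc]

theorem residueSum_residueDecomp (m : ℕ) (x : MvPolynomial σ K) :
    residueSum m (residueDecomp m x) = x := by
  induction x using MvPolynomial.induction_on' with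
  | add p q hp hq => rw [map_add, map_add, hp, hq]
  | monomial α c =>
    rw [residueDecomp_monomial, residueSum_single, expand_monomial, monomial_mul, mul_one,
      smul_expDiv_add_expMod]

/-- The component of residue zero, a left inverse of `expand m`. -/
noncomputable def contract (m : ℕ) : MvPolynomial σ K →+ MvPolynomial σ K :=
  (Finsupp.applyAddHom 0).comp (residueDecomp m).toAddMonoidHom

theorem contract_expand_mul {m : ℕ} (hm : 0 < m) (a x : MvPolynomial σ K) :
    contract m (expand m a * x) = a * contract m x := by
  simp [contract, residueDecomp_expand_mul hm]

theorem contract_expand {m : ℕ} (hm : 0 < m) (a : MvPolynomial σ K) :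
    contract m (expand m a) = a := by
  have h1 : contract m (1 : MvPolynomial σ K) = 1 := by
    have := residueDecomp_monomial m (0 : σ →₀ ℕ) (1 : K)
    simp only [contract, AddMonoidHom.comp_apply]
    change residueDecomp m (monomial (0 : σ →₀ ℕ) (1 : K)) 0 = 1
    rw [this]
    simp [expMod, expDiv]
  rw [← mul_one (expand m a), contract_expand_mul hm, h1, mul_one]

theorem prod_X_eq_monomial (A : Finset σ) :
    ∏ v ∈ A, (X v : MvPolynomial σ K) = monomial (∑ v ∈ A, Finsupp.single v 1) 1 := by
  rw [monomial_sum_one]; rfl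

/-- The ideal generated by the squarefree monomials with the given supports. -/
noncomputable def sqfreeIdeal (K : Type*) [Field K] {ι : Type*} (A : ι → Finset σ) :
    Ideal (MvPolynomial σ K) :=
  Ideal.span (Set.range fun i => ∏ v ∈ A i, (X v : MvPolynomial σ K))

theorem monomial_mem_sqfreeIdeal {ι : Type*} (A : ι → Finset σ) (i : ι) (γ : σ →₀ ℕ) (c : K)
    (h : ∀ v ∈ A i, 1 ≤ γ v) : monomial γ c ∈ sqfreeIdeal K A := by
  classical
  have hle : ∑ v ∈ A i, Finsupp.single v 1 ≤ γ := by
    intro w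
    rw [Finsupp.finsetSum_apply]
    simp only [Finsupp.single_apply]
    rw [Finset.sum_ite_eq' (A i) w]
    split_ifs with hw
    · exact h w hw
    · exact Nat.zero_le _
  have : monomial γ c = monomial (γ - ∑ v ∈ A i, Finsupp.single v 1) c *
      ∏ v ∈ A i, (X v : MvPolynomial σ K) := by
    rw [prod_X_eq_monomial, monomial_mul, tsub_add_cancel_of_le hle, mul_one]
  rw [this]
  exact Ideal.mul_mem_left _ _ (Ideal.subset_span ⟨i, rfl⟩)

theorem contract_mem_sqfreeIdeal {ι : Type*} (A : ι → Finset σ) {m : ℕ} (hm : 0 < m)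
    {x : MvPolynomial σ K} (hx : x ∈ sqfreeIdeal K A) : contract m x ∈ sqfreeIdeal K A := by
  classical
  suffices h : ∀ s, contract m (s * x) ∈ sqfreeIdeal K A by simpa using h 1
  induction hx using Submodule.span_induction with
  | zero => simp
  | add x y _ _ hx hy =>
    intro s
    rw [mul_add, map_add]
    exact Ideal.add_mem _ (hx s) (hy s)
  | smul a x _ h =>
    intro s
    rw [smul_eq_mul, ← mul_assoc]
    exact h _
  | mem x hx =>
    obtain ⟨i, rfl⟩ := hx
    intro s
    induction s using MvPolynomial.induction_on' with
    | add p q hp hq =>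
      rw [add_mul, map_add]
      exact Ideal.add_mem _ hp hq
    | monomial α c =>
      simp only [prod_X_eq_monomial, monomial_mul, mul_one]
      set γ := α + ∑ v ∈ A i, Finsupp.single v 1
      change residueDecomp m (monomial γ c) 0 ∈ _
      rw [residueDecomp_monomial, Finsupp.single_apply]
      split_ifs with h0
      · refine monomial_mem_sqfreeIdeal A i _ _ fun v hv => ?_
        have h1 : γ v % m = 0 := by simpa [expMod] using DFunLike.congr_fun h0 v
        have h2 : 1 ≤ γ v := by
          have : (Finsupp.single v 1 : σ →₀ ℕ) ≤ ∑ v ∈ A i, Finsupp.single v 1 :=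
            Finset.single_le_sum (f := fun v => (Finsupp.single v 1 : σ →₀ ℕ))
              (fun _ _ => zero_le) hv
          have h3 : (Finsupp.single v 1 : σ →₀ ℕ) v ≤ γ v :=
            (this.trans (le_add_of_nonneg_left (zero_le (a := α)))) v
          rwa [Finsupp.single_eq_same] at h3
        exact (Nat.one_le_div_iff hm).2 (Nat.le_of_dvd h2 (Nat.dvd_of_mod_eq_zero h1))
      · exact Ideal.zero_mem _

end PowerMap

section SquarefreeBound

variable {σ : Type} {K : Type u} [Field K] {ι : Type*} (A : ι → Finset σ)

theorem projective_expand {m : ℕ} (hm : 0 < m) :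
    @Module.Projective (MvPolynomial σ K) _ (MvPolynomial σ K) _
      (expand m : MvPolynomial σ K →ₐ[K] MvPolynomial σ K).toRingHom.toAlgebra.toModule :=
  projective_of_semilinear_retract _ (residueDecomp m).toAddMonoidHom
    (residueDecomp_expand_mul hm) (residueSum m) (residueSum_smul m) (residueSum_residueDecomp m)

/-- The map `S ⧸ I ⟶ S ⧸ φ(I)` induced by `φ`, as a morphism of `R`-modules. -/
noncomputable def quotMapRestrict {R R' : Type u} [CommRing R] [CommRing R'] (φ : R →+* R')
    {I : Ideal R} {P : Ideal R'} (h : I ≤ P.comap φ) :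
    ModuleCat.of R (R ⧸ I) ⟶
      (ModuleCat.restrictScalars φ).obj (ModuleCat.of R' (R' ⧸ P)) :=
  ModuleCat.ofHom (Y := (ModuleCat.restrictScalars φ).obj (ModuleCat.of R' (R' ⧸ P)))
    { toFun := Ideal.quotientMap P φ h
      map_add' := map_add _
      map_smul' := fun r x => by
        obtain ⟨x, rfl⟩ := Ideal.Quotient.mk_surjective x
        exact map_mul (Ideal.quotientMap P φ h) (Ideal.Quotient.mk I r) (Ideal.Quotient.mk I x) }

/-- The map `R' ⧸ P ⟶ R ⧸ I` induced by an additive map `ψ` that is linear along `φ`. -/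
noncomputable def quotRetract {R R' : Type u} [CommRing R] [CommRing R'] (φ : R →+* R')
    {I : Ideal R} {P : Ideal R'} (ψ : R' →+ R) (hψ : ∀ a x, ψ (φ a * x) = a * ψ x)
    (h : ∀ x ∈ P, ψ x ∈ I) :
    (ModuleCat.restrictScalars φ).obj (ModuleCat.of R' (R' ⧸ P)) ⟶ ModuleCat.of R (R ⧸ I) :=
  ModuleCat.ofHom (X := (ModuleCat.restrictScalars φ).obj (ModuleCat.of R' (R' ⧸ P)))
    { toFun := QuotientAddGroup.map P.toAddSubgroup I.toAddSubgroup ψ h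
      map_add' := map_add (QuotientAddGroup.map P.toAddSubgroup I.toAddSubgroup ψ h)
      map_smul' := fun r x => by
        obtain ⟨x, rfl⟩ := Ideal.Quotient.mk_surjective x
        exact congrArg (Ideal.Quotient.mk I) (hψ r x) }

theorem hasProjectiveDimensionLT_sqfreeIdeal [Finite σ] {r : ℕ}
    (a : Fin r → MvPolynomial σ K)
    (h₁ : sqfreeIdeal K A ≤ (Ideal.span (Set.range a)).radical)
    (h₂ : Ideal.span (Set.range a) ≤ (sqfreeIdeal K A).radical) :
    HasProjectiveDimensionLT
      (ModuleCat.of (MvPolynomial σ K) (MvPolynomial σ K ⧸ sqfreeIdeal K A)) (r + 1) := by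
  set I := sqfreeIdeal K A
  set J := Ideal.span (Set.range a)
  refine HasProjectiveDimensionLT.mk fun k hk N e => ?_
  obtain ⟨s, hs⟩ := Ideal.exists_pow_le_of_le_radical_of_fg h₂ (IsNoetherian.noetherian J)
  obtain ⟨t, ht⟩ := Ideal.exists_pow_le_of_le_radical_of_fg h₁ (IsNoetherian.noetherian I)
  obtain ⟨s', hs', hn⟩ := nullPowers_span_range a k (by omega) I s hs
  set m := t * s' + 1
  have hm : 0 < m := Nat.succ_pos _
  set φ : MvPolynomial σ K →+* MvPolynomial σ K :=
    (expand m : MvPolynomial σ K →ₐ[K] MvPolynomial σ K).toRingHom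
  have hIm : I.map φ ≤ I ^ m := by
    refine Ideal.map_le_iff_le_comap.2 (Ideal.span_le.2 ?_)
    rintro _ ⟨i, rfl⟩
    have : φ (∏ v ∈ A i, X v) = (∏ v ∈ A i, X v) ^ m := by
      simp [φ, map_prod, Finset.prod_pow]
    change φ _ ∈ I ^ m
    rw [this]
    exact Ideal.pow_mem_pow (Ideal.subset_span (Set.mem_range_self i)) m
  have hIJ : I.map φ ≤ J ^ s' := by
    refine hIm.trans ((Ideal.pow_le_pow_right (Nat.le_succ _)).trans ?_)
    rw [pow_mul]
    exact Ideal.pow_right_mono ht s'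
  have hn' := hn.comp_left (quotProj hIJ)
  rw [quotProj_comp] at hn'
  have key := ((extNull_restrictScalars φ (projective_expand hm) hn').comp_left
    (quotMapRestrict φ Ideal.le_comap_map)).comp_right
    (quotRetract φ (contract m) (contract_expand_mul hm)
      fun x hx => contract_mem_sqfreeIdeal A hm hx)
  have hid : (quotMapRestrict φ Ideal.le_comap_map ≫
      (ModuleCat.restrictScalars φ).map (quotProj (hIJ.trans hs'))) ≫
      quotRetract φ (contract m) (contract_expand_mul hm)
        (fun x hx => contract_mem_sqfreeIdeal A hm hx) = 𝟙 (ModuleCat.of _ (_ ⧸ I)) := by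
    refine ModuleCat.hom_ext (LinearMap.ext fun x => ?_)
    obtain ⟨x, rfl⟩ := Ideal.Quotient.mk_surjective x
    exact congrArg (Ideal.Quotient.mk I) (contract_expand hm x)
  rw [hid] at key
  have h0 := key e
  rw [Abelian.Ext.mk₀_id_comp] at h0
  exact h0

end SquarefreeBound

section ExternalTensor

open TensorProduct

/-- The tensor product over `K` of an `A`-module and a `B`-module, seen as an
`A ⊗[K] B`-module. -/
def Box (K X Y : Type u) [Field K] [AddCommGroup X] [AddCommGroup Y] [Module K X] [Module K Y] :
    Type u := X ⊗[K] Y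

namespace Box

variable (K : Type u) [Field K] {A B : Type u} [CommRing A] [CommRing B] [Algebra K A] [Algebra K B]
variable {X Y X' Y' X'' Y'' : Type u}
  [AddCommGroup X] [Module K X] [Module A X] [IsScalarTower K A X]
  [AddCommGroup X'] [Module K X'] [Module A X'] [IsScalarTower K A X']
  [AddCommGroup X''] [Module K X''] [Module A X''] [IsScalarTower K A X'']
  [AddCommGroup Y] [Module K Y] [Module B Y] [IsScalarTower K B Y]
  [AddCommGroup Y'] [Module K Y'] [Module B Y'] [IsScalarTower K B Y']
  [AddCommGroup Y''] [Module K Y''] [Module B Y''] [IsScalarTower K B Y'']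

noncomputable instance : AddCommGroup (Box K X Y) := inferInstanceAs (AddCommGroup (X ⊗[K] Y))

noncomputable instance : Module K (Box K X Y) := inferInstanceAs (Module K (X ⊗[K] Y))

noncomputable instance : Module (A ⊗[K] B) (Box K X Y) :=
  Module.compHom (X ⊗[K] Y)
    ((Module.endTensorEndAlgHom (R := K) (S := K) (A := K) (M := X) (N := Y)).comp
      (Algebra.TensorProduct.map (Algebra.lsmul K K X : A →ₐ[K] _)
        (Algebra.lsmul K K Y : B →ₐ[K] _))).toRingHom

/-- The external tensor product of two elements. -/
noncomputable def tmul (x : X) (y : Y) : Box K X Y := (x ⊗ₜ[K] y : X ⊗[K] Y)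

variable {K}

theorem smul_tmul (a : A) (b : B) (x : X) (y : Y) :
    (a ⊗ₜ[K] b) • tmul K x y = tmul K (a • x) (b • y) := rfl

theorem tmul_add (x : X) (y y' : Y) : tmul K x (y + y') = tmul K x y + tmul K x y' :=
  TensorProduct.tmul_add _ _ _

theorem add_tmul (x x' : X) (y : Y) : tmul K (x + x') y = tmul K x y + tmul K x' y :=
  TensorProduct.add_tmul _ _ _

@[elab_as_elim]
theorem induction_on {p : Box K X Y → Prop} (z : Box K X Y) (h0 : p 0)
    (ht : ∀ x y, p (tmul K x y)) (ha : ∀ z w, p z → p w → p (z + w)) : p z :=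
  TensorProduct.induction_on (motive := p) z h0 ht ha

/-- An additive map between external products is linear as soon as it is so on pure tensors. -/
noncomputable def mkLinear {Z : Type u} [AddCommGroup Z] [Module (A ⊗[K] B) Z]
    (f : Box K X Y →+ Z)
    (hf : ∀ (a : A) (b : B) x y, f (tmul K (a • x) (b • y)) = (a ⊗ₜ[K] b) • f (tmul K x y)) :
    Box K X Y →ₗ[A ⊗[K] B] Z where
  __ := f
  map_smul' t z := by
    change f (t • z) = t • f z
    induction t with
    | zero => simp
    | add t t' ht ht' => simp only [add_smul, map_add, ht, ht']
    | tmul a b =>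
      induction z using induction_on with
      | h0 => simp
      | ha z w hz hw => simp only [smul_add, map_add, hz, hw]
      | ht x y => rw [smul_tmul, hf]

/-- Functoriality of the external tensor product. -/
noncomputable def map (f : X →ₗ[A] X') (g : Y →ₗ[B] Y') :
    Box K X Y →ₗ[A ⊗[K] B] Box K X' Y' :=
  mkLinear (Z := Box K X' Y')
    (TensorProduct.map (f.restrictScalars K) (g.restrictScalars K)).toAddMonoidHom
    (fun a b x y => by
      change tmul K (f (a • x)) (g (b • y)) = _
      rw [map_smul, map_smul]
      rfl)

@[simp]
theorem map_tmul (f : X →ₗ[A] X') (g : Y →ₗ[B] Y') (x : X) (y : Y) :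
    map (K := K) f g (tmul K x y) = tmul K (f x) (g y) := rfl

theorem map_map (f : X →ₗ[A] X') (g : Y →ₗ[B] Y') (f' : X' →ₗ[A] X'') (g' : Y' →ₗ[B] Y'')
    (z : Box K X Y) : map f' g' (map f g z) = map (f'.comp f) (g'.comp g) z := by
  induction z using induction_on with
  | h0 => simp
  | ht x y => simp
  | ha z w hz hw => simp only [map_add, hz, hw]

@[simp]
theorem map_id (z : Box K X Y) :
    map (LinearMap.id : X →ₗ[A] X) (LinearMap.id : Y →ₗ[B] Y) z = z := by
  induction z using induction_on with
  | h0 => simp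
  | ht x y => simp
  | ha z w hz hw => simp only [map_add, hz, hw]

theorem map_surjective {f : X →ₗ[A] X'} {g : Y →ₗ[B] Y'} (hf : Function.Surjective f)
    (hg : Function.Surjective g) : Function.Surjective (map (K := K) f g) :=
  TensorProduct.map_surjective (g := f.restrictScalars K) (g' := g.restrictScalars K) hf hg

theorem map_id_injective {g : Y →ₗ[B] Y'} (hg : Function.Injective g) :
    Function.Injective (map (K := K) (LinearMap.id : X →ₗ[A] X) g) :=
  Module.Flat.lTensor_preserves_injective_linearMap (M := X) (g.restrictScalars K) hg

theorem map_id_injective' {f : X →ₗ[A] X'} (hf : Function.Injective f) :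
    Function.Injective (map (K := K) f (LinearMap.id : Y →ₗ[B] Y)) :=
  Module.Flat.rTensor_preserves_injective_linearMap (M := Y) (f.restrictScalars K) hf

theorem map_id_exact {g : Y →ₗ[B] Y'} {g' : Y' →ₗ[B] Y''} (h : Function.Exact g g') :
    Function.Exact (map (K := K) (LinearMap.id : X →ₗ[A] X) g)
      (map (K := K) (LinearMap.id : X →ₗ[A] X) g') :=
  Module.Flat.lTensor_exact X (f := g.restrictScalars K) (g := g'.restrictScalars K) h

theorem map_id_exact' {f : X →ₗ[A] X'} {f' : X' →ₗ[A] X''} (h : Function.Exact f f') :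
    Function.Exact (map (K := K) f (LinearMap.id : Y →ₗ[B] Y))
      (map (K := K) f' (LinearMap.id : Y →ₗ[B] Y)) :=
  Module.Flat.rTensor_exact Y (f := f.restrictScalars K) (g := f'.restrictScalars K) h

variable (K)

/-- The external product of two free modules is free. -/
noncomputable def finsuppEquiv (ι κ : Type u) :
    Box K (ι →₀ A) (κ →₀ B) ≃ₗ[A ⊗[K] B] (ι × κ →₀ A ⊗[K] B) :=
  LinearEquiv.ofBijective
    (mkLinear (finsuppTensorFinsupp K K A B ι κ).toLinearMap.toAddMonoidHom
      (fun a b x y => by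
        change finsuppTensorFinsupp K K A B ι κ ((a • x) ⊗ₜ (b • y)) =
          (a ⊗ₜ[K] b) • finsuppTensorFinsupp K K A B ι κ (x ⊗ₜ y)
        ext ⟨i, j⟩
        simp))
    (finsuppTensorFinsupp K K A B ι κ).bijective

variable (X Y) in
theorem projective [Module.Projective A X] [Module.Projective B Y] :
    Module.Projective (A ⊗[K] B) (Box K X Y) := by
  obtain ⟨s, hs⟩ := Module.projective_def'.1 ‹Module.Projective A X›
  obtain ⟨t, ht⟩ := Module.projective_def'.1 ‹Module.Projective B Y›
  have : Module.Projective (A ⊗[K] B) (Box K (X →₀ A) (Y →₀ B)) :=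
    Module.Projective.of_equiv (finsuppEquiv K X Y).symm
  refine Module.Projective.of_split (map s t)
    (map (Finsupp.linearCombination A id) (Finsupp.linearCombination B id)) ?_
  ext z
  rw [LinearMap.comp_apply, map_map, hs, ht, map_id]
  rfl

end Box

end ExternalTensor

section ModuleDimension

variable {R : Type u} [CommRing R] {M N P : Type u} [AddCommGroup M] [Module R M]
  [AddCommGroup N] [Module R N] [AddCommGroup P] [Module R P]

/-- The module `M` has projective dimension less than `n`. -/
abbrev PdLT (R : Type u) [CommRing R] (M : Type u) [AddCommGroup M] [Module R M] (n : ℕ) : Prop :=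
  HasProjectiveDimensionLT (ModuleCat.of R M) n

theorem pdLT_one_iff : PdLT R M 1 ↔ Module.Projective R M := by
  rw [PdLT, ← projective_iff_hasProjectiveDimensionLT_one, ← IsProjective.iff_projective]

theorem PdLT.mono {m n : ℕ} (h : PdLT R M m) (hmn : m ≤ n) : PdLT R M n :=
  hasProjectiveDimensionLT_of_ge _ m n hmn

theorem Module.Projective.pdLT [h : Module.Projective R M] (n : ℕ) : PdLT R M (n + 1) :=
  (pdLT_one_iff.2 h).mono (by omega)

variable {f : M →ₗ[R] N} {g : N →ₗ[R] P}

theorem PdLT.of_exact_left (hf : Function.Injective f) (hg : Function.Surjective g)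
    (hfg : Function.Exact f g) {n : ℕ} (hN : PdLT R N n) (hP : PdLT R P (n + 1)) :
    PdLT R M n := by
  let S := ShortComplex.mk (ModuleCat.ofHom f) (ModuleCat.ofHom g)
    (by ext x; exact hfg.apply_apply_eq_zero x)
  have hS : S.ShortExact := ModuleCat.shortComplex_shortExact S hfg hf hg
  exact hS.hasProjectiveDimensionLT_X₁ n hN hP

theorem PdLT.of_exact_right (hf : Function.Injective f) (hg : Function.Surjective g)
    (hfg : Function.Exact f g) {n : ℕ} (hM : PdLT R M n) (hN : PdLT R N (n + 1)) :
    PdLT R P (n + 1) := by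
  let S := ShortComplex.mk (ModuleCat.ofHom f) (ModuleCat.ofHom g)
    (by ext x; exact hfg.apply_apply_eq_zero x)
  have hS : S.ShortExact := ModuleCat.shortComplex_shortExact S hfg hf hg
  exact hS.hasProjectiveDimensionLT_X₃ n hM hN

theorem projective_of_exact_of_retraction [Module.Projective R N] (hf : Function.Injective f)
    (hg : Function.Surjective g) (hfg : Function.Exact f g) (w : N →ₗ[R] M)
    (hw : w ∘ₗ f = LinearMap.id) : Module.Projective R P := by
  have hl : ∃ l, l ∘ₗ f = LinearMap.id := ⟨w, hw⟩
  obtain ⟨s, hs⟩ := ((hfg.split_tfae hf hg).out 0 1).2 hl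
  exact Module.Projective.of_split s g hs

theorem exists_retraction_of_exact_of_projective [Module.Projective R P]
    (hf : Function.Injective f) (hg : Function.Surjective g) (hfg : Function.Exact f g) :
    ∃ w : N →ₗ[R] M, w ∘ₗ f = LinearMap.id :=
  ((hfg.split_tfae hf hg).out 0 1).1 (Module.projective_lifting_property g LinearMap.id hg)

variable (R M) in
theorem surjective_linearCombination_id :
    Function.Surjective (Finsupp.linearCombination R (id : M → M)) :=
  fun x => ⟨Finsupp.single x 1, by simp⟩

end ModuleDimension

namespace Box

open TensorProduct

variable (K : Type u) [Field K] {A B : Type u} [CommRing A] [CommRing B] [Algebra K A] [Algebra K B]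
variable (X Y : Type u)
  [AddCommGroup X] [Module K X] [Module A X] [IsScalarTower K A X]
  [AddCommGroup Y] [Module K Y] [Module B Y] [IsScalarTower K B Y]

theorem pdLT_of_projective_left [Module.Projective A X] {m : ℕ} (hY : PdLT B Y (m + 1)) :
    PdLT (A ⊗[K] B) (Box K X Y) (m + 1) := by
  induction m generalizing Y with
  | zero =>
    have := pdLT_one_iff.1 hY
    have := Box.projective K (A := A) (B := B) X Y
    exact this.pdLT 0
  | succ m ih =>
    let g := Finsupp.linearCombination B (id : Y → Y)
    have hg : Function.Surjective g := surjective_linearCombination_id B Y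
    have hfg : Function.Exact (LinearMap.ker g).subtype g := LinearMap.exact_subtype_ker_map g
    have hf : Function.Injective (LinearMap.ker g).subtype := Subtype.val_injective
    have hker : PdLT B (LinearMap.ker g) (m + 1) :=
      PdLT.of_exact_left hf hg hfg (Module.Projective.pdLT m) hY
    have := Box.projective K (A := A) (B := B) X (Y →₀ B)
    exact PdLT.of_exact_right (map_id_injective (K := K) (X := X) (A := A) hf)
      (map_surjective Function.surjective_id hg) (map_id_exact hfg) (ih _ hker) (this.pdLT _)

theorem pdLT {n m : ℕ} (hX : PdLT A X (n + 1)) (hY : PdLT B Y (m + 1)) :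
    PdLT (A ⊗[K] B) (Box K X Y) (n + m + 1) := by
  induction n generalizing X with
  | zero =>
    have := pdLT_one_iff.1 hX
    rw [Nat.zero_add]
    exact pdLT_of_projective_left K X Y hY
  | succ n ih =>
    let g := Finsupp.linearCombination A (id : X → X)
    have hg : Function.Surjective g := surjective_linearCombination_id A X
    have hfg : Function.Exact (LinearMap.ker g).subtype g := LinearMap.exact_subtype_ker_map g
    have hf : Function.Injective (LinearMap.ker g).subtype := Subtype.val_injective
    have hker : PdLT A (LinearMap.ker g) (n + 1) :=
      PdLT.of_exact_left hf hg hfg (Module.Projective.pdLT n) hX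
    rw [show n + 1 + m + 1 = (n + m + 1) + 1 by omega]
    exact PdLT.of_exact_right (map_id_injective' (K := K) (Y := Y) (B := B) hf)
      (map_surjective hg Function.surjective_id) (map_id_exact' hfg) (ih _ hker)
      ((pdLT_of_projective_left K (A := A) (X →₀ A) Y hY).mono (by omega))

end Box

namespace Box

open TensorProduct

variable {K : Type u} [Field K] {A B : Type u} [CommRing A] [CommRing B] [Algebra K A] [Algebra K B]

section Slice

variable {X Y : Type u}
  [AddCommGroup X] [Module K X] [Module A X] [IsScalarTower K A X]
  [AddCommGroup Y] [Module K Y] [Module B Y] [IsScalarTower K B Y]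

/-- Contraction of the right factor against a functional. -/
noncomputable def sliceRight (b : Y →ₗ[K] K) : Box K X Y →ₗ[K] X :=
  (TensorProduct.rid K X).toLinearMap ∘ₗ LinearMap.lTensor X b

/-- Contraction of the left factor against a functional. -/
noncomputable def sliceLeft (a : X →ₗ[K] K) : Box K X Y →ₗ[K] Y :=
  (TensorProduct.lid K Y).toLinearMap ∘ₗ LinearMap.rTensor Y a

@[simp]
theorem sliceRight_tmul (b : Y →ₗ[K] K) (x : X) (y : Y) :
    sliceRight b (tmul K x y) = b y • x := by
  change TensorProduct.rid K X (x ⊗ₜ b y) = _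
  simp

@[simp]
theorem sliceLeft_tmul (a : X →ₗ[K] K) (x : X) (y : Y) :
    sliceLeft a (tmul K x y) = a x • y := by
  change TensorProduct.lid K Y (a x ⊗ₜ y) = _
  simp

theorem sliceRight_smul (b : Y →ₗ[K] K) (a : A) (z : Box K X Y) :
    sliceRight b ((a ⊗ₜ[K] (1 : B)) • z) = a • sliceRight b z := by
  induction z using induction_on with
  | h0 => simp
  | ht x y => rw [smul_tmul, sliceRight_tmul, sliceRight_tmul, one_smul, ← smul_algebra_smul_comm (b y) a x]
  | ha z w hz hw => simp only [smul_add, map_add, hz, hw]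

theorem sliceLeft_smul (a : X →ₗ[K] K) (b : B) (z : Box K X Y) :
    sliceLeft a (((1 : A) ⊗ₜ[K] b) • z) = b • sliceLeft a z := by
  induction z using induction_on with
  | h0 => simp
  | ht x y => rw [smul_tmul, sliceLeft_tmul, sliceLeft_tmul, one_smul, ← smul_algebra_smul_comm (a x) b y]
  | ha z w hz hw => simp only [smul_add, map_add, hz, hw]

theorem apply_sliceRight (a : X →ₗ[K] K) (b : Y →ₗ[K] K) (z : Box K X Y) :
    a (sliceRight b z) = b (sliceLeft a z) := by
  induction z using induction_on with
  | h0 => simp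
  | ht x y => simp [mul_comm]
  | ha z w hz hw => simp only [map_add, hz, hw]

end Slice

variable {P F X Q G Y : Type u}
  [AddCommGroup P] [Module K P] [Module A P] [IsScalarTower K A P]
  [AddCommGroup F] [Module K F] [Module A F] [IsScalarTower K A F]
  [AddCommGroup X] [Module K X] [Module A X] [IsScalarTower K A X]
  [AddCommGroup Q] [Module K Q] [Module B Q] [IsScalarTower K B Q]
  [AddCommGroup G] [Module K G] [Module B G] [IsScalarTower K B G]
  [AddCommGroup Y] [Module K Y] [Module B Y] [IsScalarTower K B Y]
  {d : P →ₗ[A] F} {e : F →ₗ[A] X} {d' : Q →ₗ[B] G} {e' : G →ₗ[B] Y}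

/-- If the external product of two modules with given presentations has projective dimension at
most one, then the Koszul-type inclusion of the product of the syzygies is split. -/
theorem exists_homotopy (hd : Function.Injective d) (he : Function.Surjective e)
    (hde : Function.Exact d e) (hd' : Function.Injective d') (he' : Function.Surjective e')
    (hde' : Function.Exact d' e') [Module.Projective A F] [Module.Projective B G]
    (h : PdLT (A ⊗[K] B) (Box K X Y) 2) :
    ∃ (v : Box K P G →ₗ[A ⊗[K] B] Box K P Q) (w : Box K F Q →ₗ[A ⊗[K] B] Box K P Q),
      ∀ z, v (map (.id : P →ₗ[A] P) d' z) - w (map d (.id : Q →ₗ[B] Q) z) = z := by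
  have := Box.projective K (A := A) (B := B) F G
  let E : Box K F G →ₗ[A ⊗[K] B] Box K X Y := map e e'
  have hE : Function.Surjective E := map_surjective he he'
  have hK : Module.Projective (A ⊗[K] B) (LinearMap.ker E) :=
    pdLT_one_iff.1 (PdLT.of_exact_left (LinearMap.ker E).injective_subtype hE
      (LinearMap.exact_subtype_ker_map E) (this.pdLT 0) h)
  let Ψ : Box K P G × Box K F Q →ₗ[A ⊗[K] B] Box K F G :=
    (map d (.id : G →ₗ[B] G)).coprod (map (.id : F →ₗ[A] F) d')
  have hΨ : ∀ x, Ψ x = map d (.id : G →ₗ[B] G) x.1 + map (.id : F →ₗ[A] F) d' x.2 := fun x => rfl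
  have hed : e ∘ₗ d = 0 := LinearMap.ext hde.apply_apply_eq_zero
  have hed' : e' ∘ₗ d' = 0 := LinearMap.ext hde'.apply_apply_eq_zero
  have hE₁ : ∀ z : Box K F G, E z = map (.id : X →ₗ[A] X) e' (map e (.id : G →ₗ[B] G) z) := fun z => by
    rw [map_map]; rfl
  have hE₂ : ∀ z : Box K F G, E z = map e (.id : Y →ₗ[B] Y) (map (.id : F →ₗ[A] F) e' z) := fun z => by
    rw [map_map]; rfl
  have hcomm : ∀ z : Box K F Q, map e (.id : G →ₗ[B] G) (map (.id : F →ₗ[A] F) d' z) =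
      map (.id : X →ₗ[A] X) d' (map e (.id : Q →ₗ[B] Q) z) := fun z => by
    rw [map_map, map_map]; rfl
  have hcomm' : ∀ z : Box K P Q, map d (.id : G →ₗ[B] G) (map (.id : P →ₗ[A] P) d' z) =
      map (.id : F →ₗ[A] F) d' (map d (.id : Q →ₗ[B] Q) z) := fun z => by
    rw [map_map, map_map]; rfl
  have hEΨ : ∀ x, Ψ x ∈ LinearMap.ker E := fun x => by
    rw [LinearMap.mem_ker, hΨ, map_add, hE₁, hE₂ (map _ _ _),
      (map_id_exact' hde).apply_apply_eq_zero, (map_id_exact hde').apply_apply_eq_zero,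
      map_zero, map_zero, add_zero]
  let Ψ' : Box K P G × Box K F Q →ₗ[A ⊗[K] B] LinearMap.ker E := Ψ.codRestrict _ hEΨ
  have hΨ' : Function.Surjective Ψ' := by
    rintro ⟨z, hz⟩
    rw [LinearMap.mem_ker, hE₁] at hz
    obtain ⟨w', hw'⟩ := (map_id_exact hde' _).1 hz
    obtain ⟨w, rfl⟩ := map_surjective (K := K) he (Function.surjective_id (α := Q))
      (f := e) (g := (LinearMap.id : Q →ₗ[B] Q)) w'
    have hzero : map e (.id : G →ₗ[B] G) (z - map (.id : F →ₗ[A] F) d' w) = 0 := by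
      rw [map_sub, hcomm, hw', sub_self]
    obtain ⟨p, hp⟩ := (map_id_exact' hde _).1 hzero
    refine ⟨(p, w), Subtype.ext ?_⟩
    change Ψ (p, w) = z
    rw [hΨ, hp, sub_add_cancel]
  let ι : Box K P Q →ₗ[A ⊗[K] B] Box K P G × Box K F Q :=
    (map (.id : P →ₗ[A] P) d').prod (-map d (.id : Q →ₗ[B] Q))
  have hι : Function.Injective ι := fun x y hxy =>
    map_id_injective hd' (congrArg Prod.fst hxy)
  have hex : Function.Exact ι Ψ' := by
    rintro ⟨p, q⟩
    rw [← (LinearMap.ker E).subtype.map_eq_zero_iff (LinearMap.ker E).injective_subtype]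
    change Ψ (p, q) = 0 ↔ _
    constructor
    · intro hpq
      rw [hΨ] at hpq
      have h₁ := congrArg (map e (.id : G →ₗ[B] G)) hpq
      rw [map_add, (map_id_exact' hde).apply_apply_eq_zero, zero_add, hcomm, map_zero] at h₁
      have h₂ : map e (.id : Q →ₗ[B] Q) q = 0 := map_id_injective hd' (by rw [h₁, map_zero])
      obtain ⟨z, rfl⟩ := (map_id_exact' hde _).1 h₂
      refine ⟨-z, Prod.ext ?_ ?_⟩
      · change map (.id : P →ₗ[A] P) d' (-z) = p
        apply map_id_injective' (B := B) hd
        rw [hcomm', map_neg, map_neg]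
        exact (eq_neg_of_add_eq_zero_left hpq).symm
      · change -(map d (.id : Q →ₗ[B] Q) (-z)) = _
        rw [map_neg, neg_neg]
    · rintro ⟨z, hz⟩
      rw [← hz, hΨ]
      change map d (.id : G →ₗ[B] G) (map (.id : P →ₗ[A] P) d' z) + map (.id : F →ₗ[A] F) d' (-map d (.id : Q →ₗ[B] Q) z) = 0
      rw [hcomm', map_neg, add_neg_cancel]
  obtain ⟨r, hr⟩ := exists_retraction_of_exact_of_projective hι hΨ' hex
  refine ⟨r ∘ₗ LinearMap.inl _ _ _, r ∘ₗ LinearMap.inr _ _ _, fun z => ?_⟩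
  conv_rhs => rw [← LinearMap.id_apply (R := A ⊗[K] B) z, ← hr]
  simp only [LinearMap.comp_apply]
  rw [← map_sub]
  congr 1
  ext <;> simp [ι]

theorem projective_or_projective (hd : Function.Injective d) (he : Function.Surjective e)
    (hde : Function.Exact d e) (hd' : Function.Injective d') (he' : Function.Surjective e')
    (hde' : Function.Exact d' e') [Module.Projective A F] [Module.Projective B G]
    [Module.Finite B Q] (h : PdLT (A ⊗[K] B) (Box K X Y) 2) :
    Module.Projective A X ∨ Module.Projective B Y := by
  refine or_iff_not_imp_right.2 fun hY => ?_
  obtain ⟨v, u, huv⟩ := exists_homotopy (K := K) hd he hde hd' he' hde' h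
  obtain ⟨q, b, hb⟩ := Module.Finite.exists_fin (R := B) (M := Q)
  let W : Submodule K (Fin q → Q) :=
    { carrier := {x | ∃ w : G →ₗ[B] Q, ∀ j, x j = w (d' (b j))}
      zero_mem' := ⟨0, fun j => by simp⟩
      add_mem' := by
        rintro x y ⟨w, hw⟩ ⟨w', hw'⟩
        exact ⟨w + w', fun j => by simp [hw, hw']⟩
      smul_mem' := by
        rintro c x ⟨w, hw⟩
        exact ⟨algebraMap K B c • w, fun j => by simp [hw]⟩ }
  have hbW : b ∉ W := by
    rintro ⟨w, hw⟩
    refine hY (projective_of_exact_of_retraction hd' he' hde' w ?_)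
    refine LinearMap.ext_on_range (v := b) hb fun j => ?_
    rw [LinearMap.comp_apply, ← hw, LinearMap.id_apply]
  obtain ⟨β, hβ, hβW⟩ := Submodule.exists_le_ker_of_notMem hbW
  let βs : Fin q → Q →ₗ[K] K := fun j => β ∘ₗ LinearMap.single K (fun _ => Q) j
  have hβs : ∀ x, ∑ j, βs j (x j) = β x := fun x => by
    simp only [βs, LinearMap.comp_apply, ← map_sum]
    congr 1
    exact LinearMap.sum_single_apply _ x
  let r : F →ₗ[A] P :=
    { toFun := fun x => ∑ j, sliceRight (βs j) (u (tmul K x (b j)))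
      map_add' := fun x y => by
        simp only [add_tmul, map_add, Finset.sum_add_distrib]
      map_smul' := fun a x => by
        rw [RingHom.id_apply, Finset.smul_sum]
        refine Finset.sum_congr rfl fun j _ => ?_
        rw [← sliceRight_smul (B := B), ← map_smul u, smul_tmul, one_smul] }
  have hvan : ∀ p, ∑ j, sliceRight (βs j) (v (tmul K p (d' (b j)))) = 0 := fun p => by
    rw [← Module.forall_dual_apply_eq_zero_iff K]
    intro φ
    let w : G →ₗ[B] Q :=
      { toFun := fun y => sliceLeft φ (v (tmul K p y))
        map_add' := fun x y => by simp only [tmul_add, map_add]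
        map_smul' := fun c y => by
          rw [RingHom.id_apply, ← sliceLeft_smul (A := A), ← map_smul v, smul_tmul, one_smul] }
    have hw : (fun j => w (d' (b j))) ∈ W := ⟨w, fun j => rfl⟩
    rw [map_sum, ← LinearMap.mem_ker.1 (hβW hw), ← hβs]
    exact Finset.sum_congr rfl fun j _ => apply_sliceRight _ _ _
  have hrd : ∀ p, r (d p) = -(β b • p) := fun p => by
    have hsum : r (d p) = ∑ j, (sliceRight (βs j) (v (tmul K p (d' (b j)))) - βs j (b j) • p) := by
      change ∑ j, sliceRight (βs j) (u (tmul K (d p) (b j))) = _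
      refine Finset.sum_congr rfl fun j _ => ?_
      have := huv (tmul K p (b j))
      simp only [map_tmul, LinearMap.id_apply] at this
      rw [← sliceRight_tmul (βs j) p (b j), ← map_sub, ← this, sub_sub_cancel]
    rw [hsum, Finset.sum_sub_distrib, hvan, ← Finset.sum_smul, hβs, zero_sub]
  refine projective_of_exact_of_retraction hd he hde (-(algebraMap K A (β b)⁻¹) • r) ?_
  ext p
  rw [LinearMap.comp_apply, LinearMap.smul_apply, hrd, neg_smul, smul_neg, neg_neg,
    algebraMap_smul, smul_smul, inv_mul_cancel₀ hβ, one_smul, LinearMap.id_apply]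

end Box

namespace Box

open TensorProduct

variable (K : Type u) [Field K] {A B : Type u} [CommRing A] [CommRing B] [Algebra K A] [Algebra K B]
variable (X Y : Type u)
  [AddCommGroup X] [Module K X] [Module A X] [IsScalarTower K A X]
  [AddCommGroup Y] [Module K Y] [Module B Y] [IsScalarTower K B Y]

theorem not_pdLT_of_pdLT_two [IsNoetherianRing B] [Module.Finite B Y]
    (hX : ¬ Module.Projective A X) (hX' : PdLT A X 2) {m : ℕ}
    (hY : PdLT B Y (m + 2)) (hY' : ¬ PdLT B Y (m + 1)) :
    ¬ PdLT (A ⊗[K] B) (Box K X Y) (m + 2) := by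
  induction m generalizing Y with
  | zero =>
    intro h
    obtain ⟨k, g, hg⟩ := Module.Finite.exists_fin' B Y
    rcases projective_or_projective (K := K) (LinearMap.ker _).injective_subtype
      (surjective_linearCombination_id A X) (LinearMap.exact_subtype_ker_map _)
      (LinearMap.ker g).injective_subtype hg (LinearMap.exact_subtype_ker_map g) h with hp | hp
    · exact hX hp
    · exact hY' (pdLT_one_iff.2 hp)
  | succ m ih =>
    intro h
    obtain ⟨k, g, hg⟩ := Module.Finite.exists_fin' B Y
    have hfg : Function.Exact (LinearMap.ker g).subtype g := LinearMap.exact_subtype_ker_map g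
    have hf : Function.Injective (LinearMap.ker g).subtype := Subtype.val_injective
    refine ih (LinearMap.ker g)
      (PdLT.of_exact_left hf hg hfg (Module.Projective.pdLT (m + 1)) hY)
      (fun h' => hY' (PdLT.of_exact_right hf hg hfg h' (Module.Projective.pdLT (m + 1)))) ?_
    refine PdLT.of_exact_left (map_id_injective (K := K) (X := X) (A := A) hf)
      (map_surjective Function.surjective_id hg) (map_id_exact hfg) ?_ h
    exact (Box.pdLT K (A := A) (B := B) X (Fin k → B) (n := 1) (m := 0) hX'
      (Module.Projective.pdLT 0)).mono (by omega)

/-- Projective dimension is superadditive for external tensor products over a field. -/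
theorem not_pdLT [IsNoetherianRing B] [Module.Finite B Y] {n m : ℕ}
    (hX : PdLT A X (n + 2)) (hX' : ¬ PdLT A X (n + 1))
    (hY : PdLT B Y (m + 2)) (hY' : ¬ PdLT B Y (m + 1)) :
    ¬ PdLT (A ⊗[K] B) (Box K X Y) (n + m + 2) := by
  induction n generalizing X with
  | zero =>
    rw [Nat.zero_add]
    exact not_pdLT_of_pdLT_two K X Y (fun h => hX' (pdLT_one_iff.2 h)) hX hY hY'
  | succ n ih =>
    intro h
    rw [show n + 1 + m + 2 = (n + m + 2) + 1 by omega] at h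
    let g := Finsupp.linearCombination A (id : X → X)
    have hg : Function.Surjective g := surjective_linearCombination_id A X
    have hfg : Function.Exact (LinearMap.ker g).subtype g := LinearMap.exact_subtype_ker_map g
    have hf : Function.Injective (LinearMap.ker g).subtype := Subtype.val_injective
    refine ih (LinearMap.ker g)
      (PdLT.of_exact_left hf hg hfg (Module.Projective.pdLT (n + 1)) hX)
      (fun h' => hX' (PdLT.of_exact_right hf hg hfg h' (Module.Projective.pdLT (n + 1)))) ?_
    refine PdLT.of_exact_left (map_id_injective' (K := K) (Y := Y) (B := B) hf)
      (map_surjective hg Function.surjective_id) (map_id_exact' hfg) ?_ h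
    exact (pdLT_of_projective_left K (A := A) (X →₀ A) Y hY).mono (by omega)

end Box

section QuotientTransport

open TensorProduct

theorem pdLT_quotient_of_ringEquiv {R R' : Type u} [CommRing R] [CommRing R'] (e : R ≃+* R')
    (I : Ideal R) (J : Ideal R') (hJ : J = I.map (e : R →+* R')) {n : ℕ}
    (h : PdLT R (R ⧸ I) (n + 1)) : PdLT R' (R' ⧸ J) (n + 1) := by
  have := RingHomInvPair.of_ringEquiv e
  have := RingHomInvPair.symm (e : R →+* R') (e.symm : R' →+* R)
  let E : (R ⧸ I) ≃ₛₗ[(e : R →+* R')] (R' ⧸ J) :=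
    { Ideal.quotientEquiv I J e hJ with
      map_smul' := fun r x => by
        obtain ⟨x, rfl⟩ := Ideal.Quotient.mk_surjective x
        exact map_mul (Ideal.quotientEquiv I J e hJ) (Ideal.Quotient.mk I r)
          (Ideal.Quotient.mk I x) }
  have : HasProjectiveDimensionLE (ModuleCat.of R (R ⧸ I)) n := h
  exact ModuleCat.hasProjectiveDimensionLE_of_semiLinearEquiv e
    (M := ModuleCat.of R (R ⧸ I)) (N := ModuleCat.of R' (R' ⧸ J)) E n

theorem pdLT_of_linearEquiv {R M N : Type u} [CommRing R] [AddCommGroup M] [Module R M]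
    [AddCommGroup N] [Module R N] (e : M ≃ₗ[R] N) {n : ℕ} (h : PdLT R M (n + 1)) :
    PdLT R N (n + 1) := by
  have : HasProjectiveDimensionLE (ModuleCat.of R M) n := h
  exact ModuleCat.hasProjectiveDimensionLE_of_linearEquiv
    (M := ModuleCat.of R M) (N := ModuleCat.of R N) e n

variable {K : Type u} [Field K] {A B S : Type u} [CommRing A] [CommRing B] [CommRing S]
  [Algebra K A] [Algebra K B] [Algebra K S]

/-- The external product of two cyclic modules is cyclic. -/
noncomputable def boxQuotientEquiv (I : Ideal A) (J : Ideal B) :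
    ((A ⊗[K] B) ⧸ (I.map (Algebra.TensorProduct.includeLeft : A →ₐ[K] A ⊗[K] B) ⊔
      J.map (Algebra.TensorProduct.includeRight : B →ₐ[K] A ⊗[K] B))) ≃ₗ[A ⊗[K] B]
      Box K (A ⧸ I) (B ⧸ J) :=
  let f : (A ⊗[K] B) →ₗ[A ⊗[K] B] Box K (A ⧸ I) (B ⧸ J) :=
    LinearMap.toSpanSingleton _ _ (Box.tmul K 1 1)
  have hf : ∀ t, f t = Algebra.TensorProduct.map (Ideal.Quotient.mkₐ K I)
      (Ideal.Quotient.mkₐ K J) t := fun t => by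
    induction t with
    | zero => rw [map_zero, map_zero]; rfl
    | add t t' h h' => rw [map_add, map_add, h, h']; rfl
    | tmul a b =>
      change Box.tmul K (a • (1 : A ⧸ I)) (b • (1 : B ⧸ J)) = Box.tmul K _ _
      congr 1
      · exact (Algebra.algebraMap_eq_smul_one a).symm
      · exact (Algebra.algebraMap_eq_smul_one b).symm
  have hs : Function.Surjective f := fun z => by
    obtain ⟨t, ht⟩ := TensorProduct.map_surjective
      (g := (Ideal.Quotient.mkₐ K I).toLinearMap) (g' := (Ideal.Quotient.mkₐ K J).toLinearMap)
      (Ideal.Quotient.mkₐ_surjective K I) (Ideal.Quotient.mkₐ_surjective K J) z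
    exact ⟨t, (hf t).trans ht⟩
  have hk : I.map (Algebra.TensorProduct.includeLeft : A →ₐ[K] A ⊗[K] B) ⊔
      J.map (Algebra.TensorProduct.includeRight : B →ₐ[K] A ⊗[K] B) = LinearMap.ker f := by
    have := Algebra.TensorProduct.map_ker (Ideal.Quotient.mkₐ K I) (Ideal.Quotient.mkₐ K J)
      (Ideal.Quotient.mkₐ_surjective K I) (Ideal.Quotient.mkₐ_surjective K J)
    have hI : RingHom.ker (Ideal.Quotient.mkₐ K I) = I := Ideal.Quotient.mkₐ_ker K I
    have hJ : RingHom.ker (Ideal.Quotient.mkₐ K J) = J := Ideal.Quotient.mkₐ_ker K J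
    rw [hI, hJ] at this
    rw [← this]
    ext t
    rw [LinearMap.mem_ker, hf]
    rfl
  (Submodule.quotEquivOfEq _ _ hk).trans (f.quotKerEquivOfSurjective hs)

theorem pdLT_box_quotient_iff (e : A ⊗[K] B ≃ₐ[K] S) (α : A →ₐ[K] S) (β : B →ₐ[K] S)
    (hα : ∀ a, e (a ⊗ₜ 1) = α a) (hβ : ∀ b, e (1 ⊗ₜ b) = β b) (I : Ideal A) (J : Ideal B)
    {n : ℕ} :
    PdLT (A ⊗[K] B) (Box K (A ⧸ I) (B ⧸ J)) (n + 1) ↔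
      PdLT S (S ⧸ (I.map α ⊔ J.map β)) (n + 1) := by
  have hmap : I.map α ⊔ J.map β =
      (I.map (Algebra.TensorProduct.includeLeft : A →ₐ[K] A ⊗[K] B) ⊔
      J.map (Algebra.TensorProduct.includeRight : B →ₐ[K] A ⊗[K] B)).map
        ((e : A ⊗[K] B ≃+* S) : A ⊗[K] B →+* S) := by
    have hα' : α.toRingHom = ((e : A ⊗[K] B ≃+* S) : A ⊗[K] B →+* S).comp
        (Algebra.TensorProduct.includeLeft : A →ₐ[K] A ⊗[K] B).toRingHom :=
      RingHom.ext fun a => (hα a).symm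
    have hβ' : β.toRingHom = ((e : A ⊗[K] B ≃+* S) : A ⊗[K] B →+* S).comp
        (Algebra.TensorProduct.includeRight : B →ₐ[K] A ⊗[K] B).toRingHom :=
      RingHom.ext fun a => (hβ a).symm
    rw [Ideal.map_sup]
    change I.map α.toRingHom ⊔ J.map β.toRingHom =
      (I.map (Algebra.TensorProduct.includeLeft : A →ₐ[K] A ⊗[K] B).toRingHom).map _ ⊔
      (J.map (Algebra.TensorProduct.includeRight : B →ₐ[K] A ⊗[K] B).toRingHom).map _
    rw [Ideal.map_map, Ideal.map_map, hα', hβ']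
  constructor
  · intro h
    exact pdLT_quotient_of_ringEquiv (e : A ⊗[K] B ≃+* S) _ _ hmap
      (pdLT_of_linearEquiv (boxQuotientEquiv I J).symm h)
  · intro h
    refine pdLT_of_linearEquiv (boxQuotientEquiv I J)
      (pdLT_quotient_of_ringEquiv (e : A ⊗[K] B ≃+* S).symm _ _ ?_ h)
    rw [hmap]
    exact (Ideal.map_of_equiv (e : A ⊗[K] B ≃+* S)).symm

theorem pdLT_quotient_bot (R : Type u) [CommRing R] (n : ℕ) :
    PdLT R (R ⧸ (⊥ : Ideal R)) (n + 1) :=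
  pdLT_of_linearEquiv (Submodule.quotEquivOfEqBot ⊥ rfl).symm (Module.Projective.pdLT n)

theorem pdLT_map_left (e : A ⊗[K] B ≃ₐ[K] S) (α : A →ₐ[K] S) (β : B →ₐ[K] S)
    (hα : ∀ a, e (a ⊗ₜ 1) = α a) (hβ : ∀ b, e (1 ⊗ₜ b) = β b) (I : Ideal A) {n : ℕ}
    (h : PdLT A (A ⧸ I) (n + 1)) : PdLT S (S ⧸ I.map α) (n + 1) := by
  have := (pdLT_box_quotient_iff e α β hα hβ I ⊥).1
    (Box.pdLT K (A ⧸ I) (B ⧸ (⊥ : Ideal B)) h (pdLT_quotient_bot B 0))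
  rwa [Ideal.map_bot, sup_bot_eq] at this

theorem pdLT_map_right (e : A ⊗[K] B ≃ₐ[K] S) (α : A →ₐ[K] S) (β : B →ₐ[K] S)
    (hα : ∀ a, e (a ⊗ₜ 1) = α a) (hβ : ∀ b, e (1 ⊗ₜ b) = β b) (J : Ideal B) {n : ℕ}
    (h : PdLT B (B ⧸ J) (n + 1)) : PdLT S (S ⧸ J.map β) (n + 1) := by
  have := (pdLT_box_quotient_iff e α β hα hβ ⊥ J).1
    (Box.pdLT K (A ⧸ (⊥ : Ideal A)) (B ⧸ J) (pdLT_quotient_bot A 0) h)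
  rwa [Ideal.map_bot, bot_sup_eq, Nat.zero_add] at this

end QuotientTransport

section DisjointVariables

open TensorProduct

variable {σ : Type} {K : Type u} [Field K]

/-- The polynomial ring splits as a tensor product along a partition of the variables. -/
noncomputable def splitVariables (K : Type u) [Field K] (q : σ → Prop) :
    MvPolynomial {v // q v} K ⊗[K] MvPolynomial {v // ¬ q v} K ≃ₐ[K] MvPolynomial σ K :=
  open Classical in
  (tensorEquivSum K _ _ K).trans (renameEquiv K (Equiv.sumCompl q))

theorem splitVariables_tmul_one (q : σ → Prop) (f : MvPolynomial {v // q v} K) :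
    splitVariables K q (f ⊗ₜ 1) = rename Subtype.val f := by
  have : ((splitVariables K q).toAlgHom.comp Algebra.TensorProduct.includeLeft) =
      rename Subtype.val := by
    ext v
    simp [splitVariables]
  exact DFunLike.congr_fun this f

theorem splitVariables_one_tmul (q : σ → Prop) (f : MvPolynomial {v // ¬ q v} K) :
    splitVariables K q (1 ⊗ₜ f) = rename Subtype.val f := by
  have : ((splitVariables K q).toAlgHom.comp Algebra.TensorProduct.includeRight) =
      rename Subtype.val := by
    ext v
    simp [splitVariables]
  exact DFunLike.congr_fun this f

theorem map_rename_sqfreeIdeal (q : σ → Prop) [DecidablePred q] {ι : Type*} (A : ι → Finset σ)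
    (hA : ∀ i, ∀ v ∈ A i, q v) :
    (sqfreeIdeal K fun i => (A i).subtype q).map
      (rename Subtype.val : MvPolynomial {v // q v} K →ₐ[K] MvPolynomial σ K) =
        sqfreeIdeal K A := by
  rw [sqfreeIdeal, sqfreeIdeal, Ideal.map_span, ← Set.range_comp]
  congr 2
  ext1 i
  simp only [Function.comp_apply, map_prod, rename_X]
  exact Finset.prod_subtype_of_mem (fun v => (X v : MvPolynomial σ K)) (hA i)

theorem pdLT_subtype_of_radical_eq [Finite σ] (q : σ → Prop) [DecidablePred q] {ι : Type*}
    (A : ι → Finset σ) (hA : ∀ i, ∀ v ∈ A i, q v) {r : ℕ} (a : Fin r → MvPolynomial σ K)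
    (ha : (Ideal.span (Set.range a)).radical = (sqfreeIdeal K A).radical) :
    PdLT (MvPolynomial {v // q v} K)
      (MvPolynomial {v // q v} K ⧸ sqfreeIdeal K fun i => (A i).subtype q) (r + 1) := by
  let k : MvPolynomial σ K →ₐ[K] MvPolynomial {v // q v} K :=
    killCompl (Subtype.val_injective (p := q))
  have hk : ∀ f, k (rename Subtype.val f) = f := fun f =>
    DFunLike.congr_fun (killCompl_comp_rename (Subtype.val_injective (p := q))) f
  have hka : Ideal.span (Set.range fun i => k (a i)) = (Ideal.span (Set.range a)).map k := by
    rw [Ideal.map_span, ← Set.range_comp]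
    rfl
  have hkI : (sqfreeIdeal K A).map k = sqfreeIdeal K fun i => (A i).subtype q := by
    refine le_antisymm ?_ fun f hf => ?_
    · rw [← map_rename_sqfreeIdeal q A hA, Ideal.map_le_iff_le_comap, Ideal.map_le_iff_le_comap]
      intro f hf
      rwa [Ideal.mem_comap, Ideal.mem_comap, hk]
    · rw [← hk f]
      refine Ideal.mem_map_of_mem k ?_
      rw [← map_rename_sqfreeIdeal q A hA]
      exact Ideal.mem_map_of_mem _ hf
  refine hasProjectiveDimensionLT_sqfreeIdeal _ (fun i => k (a i)) ?_ ?_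
  · rw [hka, ← hkI]
    refine (Ideal.map_mono ?_).trans (Ideal.map_radical_le k)
    exact Ideal.le_radical.trans ha.ge
  · rw [hka, ← hkI]
    refine (Ideal.map_mono ?_).trans (Ideal.map_radical_le k)
    exact Ideal.le_radical.trans ha.le

theorem not_pdLT_sup_of_disjoint [Finite σ] {ι κ : Type*} (A : ι → Finset σ) (B : κ → Finset σ)
    (hAB : ∀ i j, Disjoint (A i) (B j)) {n m : ℕ}
    (a : Fin (n + 1) → MvPolynomial σ K) (b : Fin (m + 1) → MvPolynomial σ K)
    (ha : (Ideal.span (Set.range a)).radical = (sqfreeIdeal K A).radical)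
    (hb : (Ideal.span (Set.range b)).radical = (sqfreeIdeal K B).radical)
    (hA : ¬ PdLT (MvPolynomial σ K) (MvPolynomial σ K ⧸ sqfreeIdeal K A) (n + 1))
    (hB : ¬ PdLT (MvPolynomial σ K) (MvPolynomial σ K ⧸ sqfreeIdeal K B) (m + 1)) :
    ¬ PdLT (MvPolynomial σ K) (MvPolynomial σ K ⧸ (sqfreeIdeal K A ⊔ sqfreeIdeal K B))
      (n + m + 2) := by
  classical
  let q : σ → Prop := fun v => ∃ i, v ∈ A i
  have hAq : ∀ i, ∀ v ∈ A i, q v := fun i v hv => ⟨i, hv⟩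
  have hBq : ∀ j, ∀ v ∈ B j, ¬ q v := fun j v hv ⟨i, hi⟩ =>
    Finset.disjoint_left.1 (hAB i j) hi hv
  rw [← map_rename_sqfreeIdeal q A hAq] at hA ⊢
  rw [← map_rename_sqfreeIdeal (fun v => ¬ q v) B hBq] at hB ⊢
  rw [← pdLT_box_quotient_iff (splitVariables K q) (rename Subtype.val) (rename Subtype.val)
    (splitVariables_tmul_one q) (splitVariables_one_tmul q)]
  exact Box.not_pdLT K _ _ (pdLT_subtype_of_radical_eq q A hAq a ha)
    (fun h => hA (pdLT_map_left (splitVariables K q) _ _ (splitVariables_tmul_one q)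
      (splitVariables_one_tmul q) _ h))
    (pdLT_subtype_of_radical_eq (fun v => ¬ q v) B hBq b hb)
    (fun h => hB (pdLT_map_right (splitVariables K q) _ _ (splitVariables_tmul_one q)
      (splitVariables_one_tmul q) _ h))

end DisjointVariables

section ArithmeticalRank

variable {R : Type*} [CommRing R]

theorem ara_le {I : Ideal R} {r : ℕ} (a : Fin r → R)
    (ha : (Ideal.span (Set.range a)).radical = I.radical) : ara I ≤ r :=
  Nat.sInf_le ⟨a, ha⟩

theorem exists_radical_span_eq_of_fg {I : Ideal R} (hI : I.FG) :
    ∃ a : Fin (ara I) → R, (Ideal.span (Set.range a)).radical = I.radical := by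
  obtain ⟨r, a, ha⟩ := Submodule.fg_iff_exists_fin_generating_family.1 hI
  exact Nat.sInf_mem (s := {r : ℕ | ∃ a : Fin r → R,
    (Ideal.span (Set.range a)).radical = I.radical}) ⟨r, a, congrArg Ideal.radical ha⟩

theorem ara_sup_le {I J : Ideal R} {r s : ℕ} (a : Fin r → R) (b : Fin s → R)
    (ha : (Ideal.span (Set.range a)).radical = I.radical)
    (hb : (Ideal.span (Set.range b)).radical = J.radical) : ara (I ⊔ J) ≤ r + s := by
  refine ara_le (Sum.elim a b ∘ finSumFinEquiv.symm) ?_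
  rw [EquivLike.range_comp, Set.Sum.elim_range, Ideal.span_union, Ideal.radical_sup, ha, hb,
    ← Ideal.radical_sup]

theorem eq_bot_of_ara_eq_zero [IsReduced R] {I : Ideal R} (hI : I.FG) (h : ara I = 0) : I = ⊥ := by
  obtain ⟨a, ha⟩ := exists_radical_span_eq_of_fg hI
  have : IsEmpty (Fin (ara I)) := by rw [h]; infer_instance
  rw [Set.range_eq_empty, Ideal.span_empty, Ideal.radical_bot_of_isReduced] at ha
  exact le_bot_iff.1 (Ideal.le_radical.trans ha.ge)

end ArithmeticalRank

theorem sqfreeIdeal_sumElim (K : Type u) [Field K] {σ ι κ : Type*} (A : ι → Finset σ)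
    (B : κ → Finset σ) : sqfreeIdeal K (Sum.elim A B) = sqfreeIdeal K A ⊔ sqfreeIdeal K B := by
  rw [sqfreeIdeal, sqfreeIdeal, sqfreeIdeal, ← Ideal.span_union, ← Set.Sum.elim_range]
  congr 2
  ext1 (i | j) <;> rfl

theorem ara_sup_eq_pdim_of_disjoint {σ : Type} [Finite σ] {K : Type u} [Field K] {ι κ : Type*}
    (A : ι → Finset σ) (B : κ → Finset σ) (hAB : ∀ i j, Disjoint (A i) (B j))
    (hA : (ara (sqfreeIdeal K A) : ℕ∞) = pdim (MvPolynomial σ K)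
      (ModuleCat.of _ (MvPolynomial σ K ⧸ sqfreeIdeal K A)))
    (hB : (ara (sqfreeIdeal K B) : ℕ∞) = pdim (MvPolynomial σ K)
      (ModuleCat.of _ (MvPolynomial σ K ⧸ sqfreeIdeal K B))) :
    (ara (sqfreeIdeal K A ⊔ sqfreeIdeal K B) : ℕ∞) = pdim (MvPolynomial σ K)
      (ModuleCat.of _ (MvPolynomial σ K ⧸ (sqfreeIdeal K A ⊔ sqfreeIdeal K B))) := by
  have hfg : ∀ I : Ideal (MvPolynomial σ K), I.FG := fun I => IsNoetherian.noetherian I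
  rcases hp : ara (sqfreeIdeal K A) with _ | n
  · rwa [eq_bot_of_ara_eq_zero (hfg _) hp, bot_sup_eq]
  rcases hq : ara (sqfreeIdeal K B) with _ | m
  · rwa [eq_bot_of_ara_eq_zero (hfg _) hq, sup_bot_eq]
  obtain ⟨a, ha⟩ := hp ▸ exists_radical_span_eq_of_fg (hfg (sqfreeIdeal K A))
  obtain ⟨b, hb⟩ := hq ▸ exists_radical_span_eq_of_fg (hfg (sqfreeIdeal K B))
  obtain ⟨c, hc⟩ := exists_radical_span_eq_of_fg (hfg (sqfreeIdeal K A ⊔ sqfreeIdeal K B))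
  have hle : ara (sqfreeIdeal K A ⊔ sqfreeIdeal K B) ≤ (n + 1) + (m + 1) := ara_sup_le a b ha hb
  have hnot : ¬ PdLT (MvPolynomial σ K)
      (MvPolynomial σ K ⧸ (sqfreeIdeal K A ⊔ sqfreeIdeal K B)) (n + m + 2) := by
    refine not_pdLT_sup_of_disjoint A B hAB a b ha hb (fun h => ?_) (fun h => ?_)
    · have := hA.trans_le (pdim_le_of_hasProjectiveDimensionLT h)
      rw [hp, Nat.cast_le] at this
      omega
    · have := hB.trans_le (pdim_le_of_hasProjectiveDimensionLT h)
      rw [hq, Nat.cast_le] at this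
      omega
  have hlt : PdLT (MvPolynomial σ K) (MvPolynomial σ K ⧸ (sqfreeIdeal K A ⊔ sqfreeIdeal K B))
      (ara (sqfreeIdeal K A ⊔ sqfreeIdeal K B) + 1) := by
    have hsum := sqfreeIdeal_sumElim K A B
    have h := hasProjectiveDimensionLT_sqfreeIdeal (Sum.elim A B) c
      (by rw [hsum, hc]; exact Ideal.le_radical) (by rw [hsum, ← hc]; exact Ideal.le_radical)
    rwa [hsum] at h
  have hge : n + m + 2 ≤ ara (sqfreeIdeal K A ⊔ sqfreeIdeal K B) := by
    by_contra! h
    exact hnot (hlt.mono h)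
  refine le_antisymm ?_ (pdim_le_of_hasProjectiveDimensionLT hlt)
  by_contra! h
  obtain ⟨d, hd⟩ := ENat.ne_top_iff_exists.1 h.ne_top
  rw [← hd, Nat.cast_lt] at h
  exact hnot (PdLT.mono (hasProjectiveDimensionLT_of_pdim_le hd.ge) (by omega))

theorem ara_add_eq_pdim
    (K : Type u) [Field K] (n μ₁ μ₂ : ℕ)
    (A₁ : Fin μ₁ → Finset (Fin n)) (A₂ : Fin μ₂ → Finset (Fin n))
    (hmin₁ : ∀ i j : Fin μ₁, i ≠ j → ¬ A₁ i ⊆ A₁ j)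
    (hmin₂ : ∀ i j : Fin μ₂, i ≠ j → ¬ A₂ i ⊆ A₂ j)
    (hdisj : ∀ (i : Fin μ₁) (j : Fin μ₂), Disjoint (A₁ i) (A₂ j))
    (I₁ I₂ : Ideal (MvPolynomial (Fin n) K))
    (hI₁ : I₁ = Ideal.span (Set.range fun i : Fin μ₁ =>
      ∏ v ∈ A₁ i, (X v : MvPolynomial (Fin n) K)))
    (hI₂ : I₂ = Ideal.span (Set.range fun i : Fin μ₂ =>
      ∏ v ∈ A₂ i, (X v : MvPolynomial (Fin n) K)))
    (h₁ : (ara I₁ : ℕ∞) = pdim (MvPolynomial (Fin n) K)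
      (ModuleCat.of (MvPolynomial (Fin n) K) (MvPolynomial (Fin n) K ⧸ I₁)))
    (h₂ : (ara I₂ : ℕ∞) = pdim (MvPolynomial (Fin n) K)
      (ModuleCat.of (MvPolynomial (Fin n) K) (MvPolynomial (Fin n) K ⧸ I₂))) :
    (ara (I₁ + I₂) : ℕ∞) = pdim (MvPolynomial (Fin n) K)
      (ModuleCat.of (MvPolynomial (Fin n) K) (MvPolynomial (Fin n) K ⧸ (I₁ + I₂))) := by
  subst hI₁ hI₂
  exact ara_sup_eq_pdim_of_disjoint A₁ A₂ hdisj h₁ h₂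
end

section
/- Let I_1, I_2 be squarefree monomial ideals of S = K[x_1,…,x_n] such that X(I_1) ∩ X(I_2) = ∅, where X(I) is the set of variables appearing in the minimal monomial generators of I. Then ara(I_1 ∩ I_2) ≤ ara I_1 + ara I_2 − 1. -/
open CategoryTheory MvPolynomial

universe u

/-- Ideals contained in the same prime ideals have the same radical. -/
theorem Ideal.radical_eq_of_forall_isPrime_le_iff {R : Type*} [CommRing R] {I J : Ideal R}
    (h : ∀ P : Ideal R, P.IsPrime → (I ≤ P ↔ J ≤ P)) : I.radical = J.radical := by
  rw [Ideal.radical_eq_sInf, Ideal.radical_eq_sInf]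
  congr 1
  ext P
  exact ⟨fun hP => ⟨(h P hP.2).1 hP.1, hP.2⟩, fun hP => ⟨(h P hP.2).2 hP.1, hP.2⟩⟩

/-- The polynomial with coefficients `a 0, …, a (r - 1)`. -/
noncomputable def polynomialOfCoeffs {R : Type*} [CommRing R] {r : ℕ} (a : Fin r → R) :
    Polynomial R :=
  ∑ i : Fin r, Polynomial.monomial (i : ℕ) (a i)

theorem polynomialOfCoeffs_coeff {R : Type*} [CommRing R] {r : ℕ} (a : Fin r → R) (i : Fin r) :
    (polynomialOfCoeffs a).coeff i = a i := by
  simp [polynomialOfCoeffs, Polynomial.finsetSum_coeff, Polynomial.coeff_monomial, Fin.val_inj]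

theorem polynomialOfCoeffs_coeff_of_le {R : Type*} [CommRing R] {r : ℕ} (a : Fin r → R) {k : ℕ}
    (hk : r ≤ k) : (polynomialOfCoeffs a).coeff k = 0 := by
  rw [polynomialOfCoeffs, Polynomial.finsetSum_coeff]
  refine Finset.sum_eq_zero fun i _ => ?_
  rw [Polynomial.coeff_monomial, if_neg (by omega)]

/-- An ideal contains the values of `a` iff the polynomial with coefficients `a` vanishes
modulo the ideal. -/
theorem span_range_le_iff_map_polynomialOfCoeffs {R : Type*} [CommRing R] {r : ℕ} (a : Fin r → R)
    (P : Ideal R) :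
    Ideal.span (Set.range a) ≤ P ↔
      (polynomialOfCoeffs a).map (Ideal.Quotient.mk P) = 0 := by
  rw [Ideal.span_le, Set.range_subset_iff, Polynomial.ext_iff]
  simp only [Polynomial.coeff_map, Polynomial.coeff_zero, Ideal.Quotient.eq_zero_iff_mem,
    SetLike.mem_coe]
  refine ⟨fun h k => ?_, fun h i => polynomialOfCoeffs_coeff a i ▸ h i⟩
  rcases lt_or_ge k r with hk | hk
  · exact polynomialOfCoeffs_coeff a ⟨k, hk⟩ ▸ h ⟨k, hk⟩
  · rw [polynomialOfCoeffs_coeff_of_le a hk]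
    exact P.zero_mem

theorem coeff_polynomialOfCoeffs_mul_of_le {R : Type*} [CommRing R] {r s : ℕ} (a : Fin r → R)
    (b : Fin s → R) {k : ℕ} (hk : r + s - 1 ≤ k) :
    (polynomialOfCoeffs a * polynomialOfCoeffs b).coeff k = 0 := by
  rw [Polynomial.coeff_mul]
  refine Finset.sum_eq_zero fun x hx => ?_
  rw [Finset.HasAntidiagonal.mem_antidiagonal] at hx
  rcases le_or_gt r x.1 with h | h
  · rw [polynomialOfCoeffs_coeff_of_le a h, zero_mul]
  · rw [polynomialOfCoeffs_coeff_of_le b (by omega), mul_zero]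

/-- In a Noetherian ring the arithmetical rank is attained. -/
theorem exists_radical_span_eq_of_ara {R : Type*} [CommRing R] [IsNoetherianRing R]
    (I : Ideal R) : ∃ a : Fin (ara I) → R, (Ideal.span (Set.range a)).radical = I.radical := by
  refine Nat.sInf_mem (s := {r : ℕ | ∃ a : Fin r → R,
    (Ideal.span (Set.range a)).radical = I.radical}) ?_
  obtain ⟨n, a, ha⟩ := Submodule.fg_iff_exists_fin_generating_family.1 (IsNoetherian.noetherian I)
  exact ⟨n, a, congrArg Ideal.radical ha⟩

/-- Subadditivity of the arithmetical rank under intersection: up to radical, `I ⊓ J` is generated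
by the coefficients of the product of two polynomials whose coefficients generate `I` and `J` up to
radical. -/
theorem ara_inf_le_add_sub_one {R : Type*} [CommRing R] [IsNoetherianRing R] (I J : Ideal R) :
    ara (I ⊓ J) ≤ ara I + ara J - 1 := by
  obtain ⟨a, ha⟩ := exists_radical_span_eq_of_ara I
  obtain ⟨b, hb⟩ := exists_radical_span_eq_of_ara J
  let c : Fin (ara I + ara J - 1) → R := fun k =>
    (polynomialOfCoeffs a * polynomialOfCoeffs b).coeff k
  have hc : polynomialOfCoeffs c = polynomialOfCoeffs a * polynomialOfCoeffs b := by
    ext k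
    rcases lt_or_ge k (ara I + ara J - 1) with hk | hk
    · exact polynomialOfCoeffs_coeff c ⟨k, hk⟩
    · rw [polynomialOfCoeffs_coeff_of_le c hk, coeff_polynomialOfCoeffs_mul_of_le a b hk]
  refine Nat.sInf_le ⟨c, Ideal.radical_eq_of_forall_isPrime_le_iff fun P hP => ?_⟩
  rw [hP.inf_le, ← hP.radical_le_iff (I := I), ← hP.radical_le_iff (I := J), ← ha, ← hb,
    hP.radical_le_iff, hP.radical_le_iff, span_range_le_iff_map_polynomialOfCoeffs,
    span_range_le_iff_map_polynomialOfCoeffs, span_range_le_iff_map_polynomialOfCoeffs, hc,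
    Polynomial.map_mul, mul_eq_zero]

/-!
Statement 9: if `I₁, I₂` are squarefree monomial ideals in disjoint sets of
variables, then `ara (I₁ ∩ I₂) ≤ ara I₁ + ara I₂ − 1`.
-/

theorem ara_inf_le
    (K : Type u) [Field K] (n μ₁ μ₂ : ℕ)
    (A₁ : Fin μ₁ → Finset (Fin n)) (A₂ : Fin μ₂ → Finset (Fin n))
    (hmin₁ : ∀ i j : Fin μ₁, i ≠ j → ¬ A₁ i ⊆ A₁ j)
    (hmin₂ : ∀ i j : Fin μ₂, i ≠ j → ¬ A₂ i ⊆ A₂ j)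
    (hdisj : ∀ (i : Fin μ₁) (j : Fin μ₂), Disjoint (A₁ i) (A₂ j))
    (I₁ I₂ : Ideal (MvPolynomial (Fin n) K))
    (hI₁ : I₁ = Ideal.span (Set.range fun i : Fin μ₁ =>
      ∏ v ∈ A₁ i, (X v : MvPolynomial (Fin n) K)))
    (hI₂ : I₂ = Ideal.span (Set.range fun i : Fin μ₂ =>
      ∏ v ∈ A₂ i, (X v : MvPolynomial (Fin n) K))) :
    ara (I₁ ⊓ I₂) ≤ ara I₁ + ara I₂ - 1 := by
  exact ara_inf_le_add_sub_one I₁ I₂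
end
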